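/- Let H be a separable real Hilbert space and let T : H → H be a positive self-adjoint compact operator whose eigenvalues {λ_n}_{n≥1} (arranged in non-increasing order, counted with multiplicity) satisfy λ_n = c₁ n^{-α₁} + c₂ n^{-α₂} + o(n^{-α₂}) as n → ∞, where c₁ > 0, c₂ ∈ ℝ, α₁, α₂ > 0, and either α₁ < α₂ < α₁ + 1/2, or α₁ = α₂ and c₂ = 0. Then the entropy numbers of T satisfy ε_m(T) = c₁ (α₁/ln 2)^{α₁} m^{-α₁} + (c₂/(α₁-α₂+1)) (α₁/ln 2)^{α₂} m^{-α₂} + o(m^{-α₂}) as m → ∞. -/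

import Mathlib

open MeasureTheory Filter Asymptotics Topology TopologicalSpace
open scoped BigOperators ENNReal NNReal

noncomputable section

/-- The `ε`-covering number of a set `K` in a (pseudo)metric space: the minimal cardinality of a
finite set of points such that every point of `K` lies within distance `ε` of one of them. -/
def coveringNumber {X : Type*} [PseudoMetricSpace X] (ε : ℝ) (K : Set X) : ℕ :=
  sInf {n : ℕ | ∃ s : Finset X, s.card = n ∧ ∀ x ∈ K, ∃ y ∈ s, dist x y ≤ ε}

/-- The metric entropy `H(ε; K) = log₂ N(ε; K)`. -/
def metricEntropy {X : Type*} [PseudoMetricSpace X] (ε : ℝ) (K : Set X) : ℝ :=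
  Real.logb 2 (coveringNumber ε K)

/-- The entropy of a continuous linear operator: the metric entropy of the closure of the image
of the closed unit ball. -/
def opEntropy {H : Type*} [NormedAddCommGroup H] [InnerProductSpace ℝ H]
    (ε : ℝ) (T : H →L[ℝ] H) : ℝ :=
  metricEntropy ε (closure (T '' Metric.closedBall 0 1))

/-- The `m`-th entropy number of a continuous linear operator. -/
def opEntropyNumber {H : Type*} [NormedAddCommGroup H] [InnerProductSpace ℝ H]
    (m : ℕ) (T : H →L[ℝ] H) : ℝ :=
  sInf {ε : ℝ | 0 < ε ∧ opEntropy ε T ≤ m}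

section BallCovering

variable {E : Type*} [NormedAddCommGroup E] [InnerProductSpace ℝ E] [FiniteDimensional ℝ E]
  [MeasurableSpace E] [BorelSpace E] (μ : Measure E) [μ.IsAddHaarMeasure]

/-- Among parallel slabs of a centred ball, the central ones are the largest. -/
theorem measureReal_closedBall_le_slab {e : E} (he : ‖e‖ = 1) {s η : ℝ} (hs : 0 ≤ s)
    (hη : 0 < η) :
    μ.real (Metric.closedBall 0 s) ≤
      2 * (s / η + 1) * μ.real {w : E | ‖w‖ ≤ s ∧ 0 ≤ inner ℝ e w ∧ inner ℝ e w ≤ η} := by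
  set W : Set E := {w : E | ‖w‖ ≤ s ∧ 0 ≤ inner ℝ e w ∧ inner ℝ e w ≤ η} with hW
  set n : ℕ := ⌊s / η⌋₊ + 1 with hn
  have hWsub : W ⊆ Metric.closedBall 0 s := fun w hw => by simpa using hw.1
  have hWfin : μ W ≠ ∞ := ((measure_mono hWsub).trans_lt measure_closedBall_lt_top).ne
  set P : Set E := ⋃ k ∈ Finset.range n, (fun w => -((k : ℝ) * η) • e + w) ⁻¹' W with hP
  have hPfin : μ.real P ≤ n * μ.real W := by
    refine (measureReal_biUnion_finset_le _ _).trans ?_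
    simp [measureReal_def, measure_preimage_add]
  have key : ∀ w : E, ‖w‖ ≤ s → 0 ≤ inner ℝ e w → w ∈ P := by
    intro w hw h0
    have hle : inner ℝ e w ≤ s := by
      calc inner ℝ e w ≤ ‖e‖ * ‖w‖ := real_inner_le_norm _ _
        _ ≤ s := by rw [he]; linarith
    have hk1 : (⌊inner ℝ e w / η⌋₊ : ℝ) * η ≤ inner ℝ e w := by
      rw [← le_div_iff₀ hη]; exact Nat.floor_le (by positivity)
    have hk2 : inner ℝ e w ≤ ((⌊inner ℝ e w / η⌋₊ : ℝ) + 1) * η := by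
      rw [← div_le_iff₀ hη]; exact (Nat.lt_floor_add_one _).le
    set k := ⌊inner ℝ e w / η⌋₊ with hk
    have hkn : k < n := by
      rw [hn, Nat.lt_succ_iff]
      exact Nat.floor_le_floor (by gcongr)
    simp only [hP, Set.mem_iUnion, Finset.mem_range]
    refine ⟨k, hkn, ?_⟩
    have hin : inner ℝ e (-((k : ℝ) * η) • e + w) = inner ℝ e w - k * η := by
      rw [inner_add_right, inner_smul_right, real_inner_self_eq_norm_sq, he]; ring
    refine ⟨?_, ?_, ?_⟩
    · refine le_trans ?_ hw
      refine le_of_sq_le_sq ?_ (norm_nonneg _)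
      rw [norm_add_sq_real, norm_smul, inner_smul_left, he]
      have : 0 ≤ (k : ℝ) * η := by positivity
      simp only [Real.norm_eq_abs, sq_abs, mul_pow, conj_trivial]
      nlinarith
    · rw [hin]; linarith
    · rw [hin]; linarith
  have hcov : Metric.closedBall 0 s ⊆ P ∪ -P := by
    intro w hw
    rw [mem_closedBall_zero_iff] at hw
    rcases le_total 0 (inner ℝ e w) with h | h
    · exact Or.inl (key w hw h)
    · exact Or.inr (key (-w) (by simpa using hw) (by simpa using h))
  have hPlt : μ P ≠ ∞ := by
    refine ((measure_biUnion_finset_le _ _).trans_lt ?_).ne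
    simp only [measure_preimage_add]
    simpa using ENNReal.mul_lt_top (ENNReal.natCast_lt_top n) hWfin.lt_top
  have hnegP : μ (-P) = μ P := Measure.measure_neg μ P
  calc μ.real (Metric.closedBall 0 s) ≤ μ.real (P ∪ -P) :=
        measureReal_mono hcov (measure_union_ne_top hPlt (by rwa [hnegP]))
    _ ≤ μ.real P + μ.real (-P) := measureReal_union_le _ _
    _ = 2 * μ.real P := by rw [measureReal_def, measureReal_def, hnegP]; ring
    _ ≤ 2 * (n * μ.real W) := by gcongr
    _ ≤ 2 * (s / η + 1) * μ.real W := by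
        rw [← mul_assoc]
        gcongr
        rw [hn]; push_cast
        gcongr
        exact Nat.floor_le (by positivity)

/-- A unit ball centred in a ball of radius `R` meets the ball of radius about `√(R² - 1)` in a
set whose relative volume is about `R⁻ᵈ`. -/
theorem measureReal_closedBall_inter_ge [Nontrivial E] {R δ : ℝ} (hR : 1 < R) (hδ : 0 < δ)
    {x : E} (hx : ‖x‖ ≤ R) :
    μ.real (Metric.closedBall 0 (√(R ^ 2 - 1) * (1 + δ))) ≤
      2 * (1 / δ + 1) * (1 + δ) ^ Module.finrank ℝ E * R ^ Module.finrank ℝ E *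
      μ.real (Metric.closedBall x 1 ∩ Metric.closedBall 0 (√(R ^ 2 - 1) * (1 + δ))) := by
  have hR0 : 0 < R := by linarith
  set ρ := √(R ^ 2 - 1) with hρ
  have hρpos : 0 < ρ := Real.sqrt_pos.2 (by nlinarith)
  have hρsq : ρ ^ 2 = R ^ 2 - 1 := Real.sq_sqrt (by nlinarith)
  obtain ⟨e, he, hxe⟩ : ∃ e : E, ‖e‖ = 1 ∧ x = ‖x‖ • e := by
    by_cases h : x = 0
    · obtain ⟨e, he⟩ := exists_norm_eq E (zero_le_one)
      exact ⟨e, he, by simp [h]⟩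
    · refine ⟨‖x‖⁻¹ • x, norm_smul_inv_norm h, ?_⟩
      rw [smul_smul, mul_inv_cancel₀ (norm_ne_zero_iff.2 h), one_smul]
  set r := ‖x‖ with hr
  have hr0 : 0 ≤ r := norm_nonneg _
  set s := ρ / R with hs
  have hspos : 0 < s := by positivity
  set η := ρ * δ with hη
  have hηpos : 0 < η := by positivity
  have hslab := measureReal_closedBall_le_slab μ he hspos.le hηpos
  set W : Set E := {w : E | ‖w‖ ≤ s ∧ 0 ≤ inner ℝ e w ∧ inner ℝ e w ≤ η} with hW
  set A := Metric.closedBall (0 : E) (ρ * (1 + δ)) with hA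
  set t := r * (ρ ^ 2 / R ^ 2) with ht
  have ht0 : 0 ≤ t := by positivity
  have hRR : ρ ^ 2 / R ^ 2 = 1 - 1 / R ^ 2 := by rw [hρsq]; field_simp
  have hssq : s ^ 2 = 1 - 1 / R ^ 2 := by rw [hs, div_pow, hRR]
  have htρ : t ^ 2 + s ^ 2 ≤ ρ ^ 2 := by
    have h1 : t ≤ R * (ρ ^ 2 / R ^ 2) := by rw [ht]; gcongr
    have h2 : t ^ 2 ≤ (R * (ρ ^ 2 / R ^ 2)) ^ 2 := by gcongr
    have h3 : (R * (ρ ^ 2 / R ^ 2)) ^ 2 + s ^ 2 = ρ ^ 2 := by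
      rw [hs, div_pow, mul_pow, div_pow]
      field_simp
      rw [hρsq]; ring
    linarith
  have hrt : (r - t) ^ 2 + s ^ 2 ≤ 1 := by
    have h1 : r - t = r * (1 / R ^ 2) := by rw [ht, hRR]; ring
    have h2 : r * (1 / R ^ 2) ≤ R * (1 / R ^ 2) := by gcongr
    have h3 : (r * (1 / R ^ 2)) ^ 2 ≤ (R * (1 / R ^ 2)) ^ 2 := by gcongr
    have h4 : (R * (1 / R ^ 2)) ^ 2 = 1 / R ^ 2 := by field_simp
    rw [h1, hssq]; linarith
  have hrt0 : 0 ≤ r - t := by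
    rw [ht, hRR]
    have : 0 ≤ r * (1 / R ^ 2) := by positivity
    linarith
  have htle : t ≤ ρ := by nlinarith
  have hsub : (fun w => (-t) • e + w) ⁻¹' W ⊆ Metric.closedBall x 1 ∩ A := by
    intro z hz
    set w := (-t) • e + z with hw
    have hzw : z = t • e + w := by rw [hw]; simp
    obtain ⟨h1, h2, h3⟩ := hz
    have h1' : ‖w‖ ^ 2 ≤ s ^ 2 := by gcongr
    constructor
    · rw [mem_closedBall_iff_norm, hzw]
      have : t • e + w - x = (t - r) • e + w := by
        conv_lhs => rw [hxe]
        rw [sub_smul]; abel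
      rw [this]
      refine le_of_sq_le_sq ?_ zero_le_one
      rw [norm_add_sq_real, norm_smul, inner_smul_left, he]
      simp only [Real.norm_eq_abs, mul_one, sq_abs, conj_trivial]
      have : 0 ≤ (r - t) * inner ℝ e w := mul_nonneg hrt0 h2
      nlinarith
    · rw [hA, mem_closedBall_zero_iff, hzw]
      refine le_of_sq_le_sq ?_ (by positivity)
      rw [norm_add_sq_real, norm_smul, inner_smul_left, he]
      simp only [Real.norm_eq_abs, mul_one, sq_abs, conj_trivial]
      have : t * inner ℝ e w ≤ ρ * (ρ * δ) := by gcongr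
      nlinarith [sq_nonneg (ρ * δ)]
  have hfin : μ (Metric.closedBall x 1 ∩ A) ≠ ∞ :=
    ((measure_mono Set.inter_subset_right).trans_lt measure_closedBall_lt_top).ne
  have hWle : μ.real W ≤ μ.real (Metric.closedBall x 1 ∩ A) := by
    have := measureReal_mono (μ := μ) hsub hfin
    rwa [measureReal_def, measure_preimage_add, ← measureReal_def] at this
  have hb1 : μ.real A = (ρ * (1 + δ)) ^ Module.finrank ℝ E * μ.real (Metric.closedBall 0 1) :=
    Measure.addHaar_real_closedBall' μ 0 (by positivity)
  have hb2 : μ.real (Metric.closedBall 0 s) =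
      s ^ Module.finrank ℝ E * μ.real (Metric.closedBall (0 : E) 1) :=
    Measure.addHaar_real_closedBall' μ 0 hspos.le
  have hρs : ρ = R * s := by rw [hs]; field_simp
  have hsη : s / η ≤ 1 / δ := by
    rw [hs, hη, div_div, div_le_div_iff₀ (by positivity) hδ]
    nlinarith [mul_pos hρpos hδ]
  calc μ.real A = (1 + δ) ^ Module.finrank ℝ E * R ^ Module.finrank ℝ E *
        μ.real (Metric.closedBall 0 s) := by
        rw [hb1, hb2, mul_pow]; nth_rw 1 [hρs]; rw [mul_pow]; ring
    _ ≤ (1 + δ) ^ Module.finrank ℝ E * R ^ Module.finrank ℝ E *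
        (2 * (1 / δ + 1) * μ.real (Metric.closedBall x 1 ∩ A)) := by
        gcongr
        refine hslab.trans ?_
        gcongr
    _ = _ := by ring

/-- Averaging: if every unit ball centred in `U` fills a definite part of `A`, then some unit ball
centred in `A` fills a definite part of `U`. -/
theorem exists_center_measure_inter_ge {A U : Set E} (hA : MeasurableSet A)
    (hU : MeasurableSet U) (hA0 : μ A ≠ 0) (hAtop : μ A ≠ ∞) (hUtop : μ U ≠ ∞) {q : ℝ≥0∞}
    (h : ∀ x ∈ U, q ≤ μ (Metric.closedBall x 1 ∩ A)) :
    ∃ y ∈ A, q * μ U ≤ μ (Metric.closedBall y 1 ∩ U) * μ A := by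
  set P : Set (E × E) := {z | dist z.1 z.2 ≤ 1} with hP
  have hPm : MeasurableSet P := (isClosed_le continuous_dist continuous_const).measurableSet
  have e1 : ∀ x, ∫⁻ y in A, P.indicator 1 (x, y) ∂μ = μ (Metric.closedBall x 1 ∩ A) := by
    intro x
    have : (fun y => P.indicator (1 : E × E → ℝ≥0∞) (x, y)) =
        (Metric.closedBall x 1).indicator 1 := by
      ext y
      simp only [Set.indicator, hP, Set.mem_ofPred_eq, Metric.mem_closedBall, dist_comm y x,
        Pi.one_apply]
    rw [this, lintegral_indicator_one Metric.isClosed_closedBall.measurableSet,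
      Measure.restrict_apply Metric.isClosed_closedBall.measurableSet]
  have e2 : ∀ y, ∫⁻ x in U, P.indicator 1 (x, y) ∂μ = μ (Metric.closedBall y 1 ∩ U) := by
    intro y
    have : (fun x => P.indicator (1 : E × E → ℝ≥0∞) (x, y)) =
        (Metric.closedBall y 1).indicator 1 := by
      ext x
      simp only [Set.indicator, hP, Set.mem_ofPred_eq, Metric.mem_closedBall, Pi.one_apply]
    rw [this, lintegral_indicator_one Metric.isClosed_closedBall.measurableSet,
      Measure.restrict_apply Metric.isClosed_closedBall.measurableSet]
  have hswap := lintegral_lintegral_swap (μ := μ.restrict U) (ν := μ.restrict A)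
    (f := fun x y => P.indicator (1 : E × E → ℝ≥0∞) (x, y))
    ((measurable_one.indicator hPm).aemeasurable)
  simp only [e1, e2] at hswap
  have hlow : q * μ U ≤ ∫⁻ y in A, μ (Metric.closedBall y 1 ∩ U) ∂μ := by
    rw [← hswap, ← setLIntegral_const]
    exact setLIntegral_mono' hU h
  have hint : ∫⁻ y in A, μ (Metric.closedBall y 1 ∩ U) ∂μ ≠ ∞ := by
    refine ((lintegral_mono fun y => measure_mono Set.inter_subset_right).trans_lt
      (?_ : ∫⁻ y in A, μ U ∂μ < ∞)).ne
    rw [setLIntegral_const]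
    exact ENNReal.mul_lt_top hUtop.lt_top hAtop.lt_top
  obtain ⟨y, hyA, hy⟩ := exists_setLAverage_le hA0 hA.nullMeasurableSet hint
  refine ⟨y, hyA, hlow.trans ?_⟩
  rwa [setLAverage_eq, ENNReal.div_le_iff hA0 hAtop] at hy

/-- Greedy covering of all but a small part of a set `B` by unit balls. -/
theorem exists_finset_measureReal_diff_le {A B : Set E} (hA : MeasurableSet A)
    (hB : MeasurableSet B) (hA0 : μ A ≠ 0) (hAtop : μ A ≠ ∞) (hBtop : μ B ≠ ∞) {p : ℝ}
    (hp0 : 0 ≤ p) (hp1 : p ≤ 1)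
    (h : ∀ x ∈ B, p * μ.real A ≤ μ.real (Metric.closedBall x 1 ∩ A)) (t : ℕ) :
    ∃ S : Finset E, S.card ≤ t ∧
      μ.real (B \ ⋃ y ∈ S, Metric.closedBall y 1) ≤ (1 - p) ^ t * μ.real B := by
  classical
  induction t with
  | zero => exact ⟨∅, by simp⟩
  | succ t ih =>
    obtain ⟨S, hS, hSμ⟩ := ih
    set U := B \ ⋃ y ∈ S, Metric.closedBall y 1 with hUdef
    have hU : MeasurableSet U := hB.diff
      (Finset.measurableSet_biUnion _ fun _ _ => Metric.isClosed_closedBall.measurableSet)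
    have hUtop : μ U ≠ ∞ := ((measure_mono Set.sdiff_subset).trans_lt hBtop.lt_top).ne
    obtain ⟨y, -, hy⟩ := exists_center_measure_inter_ge μ hA hU hA0 hAtop hUtop
      (q := ENNReal.ofReal (p * μ.real A)) (fun x hx => by
        rw [← ofReal_measureReal (((measure_mono Set.inter_subset_right).trans_lt
          hAtop.lt_top).ne : μ (Metric.closedBall x 1 ∩ A) ≠ ∞)]
        exact ENNReal.ofReal_le_ofReal (h x hx.1))
    have hIU : μ (Metric.closedBall y 1 ∩ U) ≠ ∞ :=
      ((measure_mono Set.inter_subset_right).trans_lt hUtop.lt_top).ne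
    have hApos : 0 < μ.real A := ENNReal.toReal_pos hA0 hAtop
    have hy' : p * μ.real U ≤ μ.real (Metric.closedBall y 1 ∩ U) := by
      have := ENNReal.toReal_mono (ENNReal.mul_ne_top hIU hAtop) hy
      rw [ENNReal.toReal_mul, ENNReal.toReal_mul, ENNReal.toReal_ofReal (by positivity)] at this
      simp only [← measureReal_def] at this
      refine le_of_mul_le_mul_right ?_ hApos
      linarith
    refine ⟨insert y S, (Finset.card_insert_le _ _).trans (by omega), ?_⟩
    have hset : B \ ⋃ z ∈ insert y S, Metric.closedBall z 1 =
        U \ (Metric.closedBall y 1 ∩ U) := by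
      ext z
      simp only [hUdef, Finset.set_biUnion_insert, Set.mem_sdiff, Set.mem_union, Set.mem_inter_iff]
      tauto
    rw [hset, measureReal_sdiff Set.inter_subset_right
      (Metric.isClosed_closedBall.measurableSet.inter hU) hUtop]
    calc μ.real U - μ.real (Metric.closedBall y 1 ∩ U) ≤ (1 - p) * μ.real U := by linarith
      _ ≤ (1 - p) * ((1 - p) ^ t * μ.real B) := by gcongr
      _ = _ := by ring

end BallCovering

/-- A ball of radius `R ≥ 1` can be covered by `Rᵈ` balls of radius about one, up to a factor
which is polynomial in `R` and in the inverse of the precision. -/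
theorem exists_finset_cover_closedBall (E : Type*) [NormedAddCommGroup E] [InnerProductSpace ℝ E]
    [FiniteDimensional ℝ E] {R δ : ℝ} (hR : 1 ≤ R) (hδ : 0 < δ) (hδ1 : δ ≤ 1)
    (hdim : Module.finrank ℝ E * δ ≤ 1) :
    ∃ S : Finset E, (∀ x : E, ‖x‖ ≤ R → ∃ y ∈ S, ‖x - y‖ ≤ 1 + δ) ∧
      (S.card : ℝ) ≤ 73 * R / δ ^ 3 * R ^ Module.finrank ℝ E := by
  rcases subsingleton_or_nontrivial E with hE | hE
  · refine ⟨{0}, fun x _ => ⟨0, by simp, ?_⟩, ?_⟩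
    · rw [Subsingleton.elim x 0]; simp; linarith
    · have h0 : Module.finrank ℝ E = 0 := Module.finrank_zero_of_subsingleton
      have : δ ^ 3 ≤ 1 := pow_le_one₀ hδ.le hδ1
      rw [h0]
      simp only [Finset.card_singleton, Nat.cast_one, pow_zero, mul_one]
      rw [le_div_iff₀ (by positivity)]
      linarith
  borelize E
  set μ : Measure E := Measure.addHaar
  set D := Module.finrank ℝ E with hD
  have hDpos : 0 < D := Module.finrank_pos
  set R' := R + δ with hR'
  have hR'1 : 1 < R' := by linarith
  set A := Metric.closedBall (0 : E) (√(R' ^ 2 - 1) * (1 + δ)) with hA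
  set B := Metric.closedBall (0 : E) R' with hB
  set Q := 2 * (1 / δ + 1) * (1 + δ) ^ D * R' ^ D with hQ
  have hQ1 : 1 ≤ Q := by
    have h1 : 1 ≤ (1 + δ) ^ D := one_le_pow₀ (by linarith)
    have h2 : 1 ≤ R' ^ D := one_le_pow₀ hR'1.le
    have h3 : 1 ≤ 2 * (1 / δ + 1) := by
      have : 0 < 1 / δ := by positivity
      linarith
    calc (1 : ℝ) = 1 * 1 * 1 := by norm_num
      _ ≤ Q := by rw [hQ]; gcongr
  have hQ0 : 0 < Q := by linarith
  have hApos : 0 < √(R' ^ 2 - 1) * (1 + δ) :=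
    mul_pos (Real.sqrt_pos.2 (by nlinarith)) (by linarith)
  have hp : ∀ x ∈ B, 1 / Q * μ.real A ≤ μ.real (Metric.closedBall x 1 ∩ A) := by
    intro x hx
    have := measureReal_closedBall_inter_ge μ hR'1 hδ (x := x) (by simpa [hB] using hx)
    rw [one_div, inv_mul_le_iff₀ hQ0]
    exact this
  set L := D * Real.log (R' / δ) with hL
  have hRδ : 1 ≤ R' / δ := by rw [le_div_iff₀ hδ]; linarith
  have hL0 : 0 ≤ L := mul_nonneg (Nat.cast_nonneg _) (Real.log_nonneg hRδ)
  set t := ⌊L * Q⌋₊ + 1 with ht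
  have htgt : L * Q < t := by rw [ht]; push_cast; exact Nat.lt_floor_add_one _
  obtain ⟨S, hScard, hS⟩ := exists_finset_measureReal_diff_le μ (A := A) (B := B)
    Metric.isClosed_closedBall.measurableSet Metric.isClosed_closedBall.measurableSet
    (Metric.measure_closedBall_pos μ 0 hApos).ne' measure_closedBall_lt_top.ne
    measure_closedBall_lt_top.ne (p := 1 / Q) (by positivity)
    (by rw [div_le_one hQ0]; exact hQ1) hp t
  refine ⟨S, ?_, ?_⟩
  · intro x hx
    by_contra! hcon
    have hsub : Metric.closedBall x δ ⊆ B \ ⋃ y ∈ S, Metric.closedBall y 1 := by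
      intro z hz
      rw [mem_closedBall_iff_norm] at hz
      refine ⟨?_, ?_⟩
      · rw [hB, mem_closedBall_zero_iff]
        calc ‖z‖ = ‖x + (z - x)‖ := by congr 1; abel
          _ ≤ ‖x‖ + ‖z - x‖ := norm_add_le _ _
          _ ≤ R' := by rw [hR']; linarith
      · simp only [Set.mem_iUnion, not_exists, mem_closedBall_iff_norm, not_le]
        intro y hy
        have h1 := hcon y hy
        have h2 : ‖x - y‖ ≤ ‖z - x‖ + ‖z - y‖ := by
          rw [norm_sub_rev z x]
          calc ‖x - y‖ = ‖(x - z) + (z - y)‖ := by congr 1; abel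
            _ ≤ _ := norm_add_le _ _
        linarith
    have h1 : μ.real (Metric.closedBall x δ) ≤ (1 - 1 / Q) ^ t * μ.real B :=
      (measureReal_mono hsub ((measure_mono Set.sdiff_subset).trans_lt
        measure_closedBall_lt_top).ne).trans hS
    rw [hB, Measure.addHaar_real_closedBall' μ x hδ.le,
      Measure.addHaar_real_closedBall' μ 0 (by linarith : (0 : ℝ) ≤ R'), ← mul_assoc] at h1
    have hV : 0 < μ.real (Metric.closedBall (0 : E) 1) :=
      ENNReal.toReal_pos (Metric.measure_closedBall_pos μ 0 one_pos).ne'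
        measure_closedBall_lt_top.ne
    have h2 := le_of_mul_le_mul_right h1 hV
    have h3 : (1 - 1 / Q) ^ t ≤ Real.exp (-(t / Q)) := by
      calc (1 - 1 / Q) ^ t ≤ Real.exp (-(1 / Q)) ^ t := by
            gcongr
            · rw [sub_nonneg, div_le_one hQ0]; exact hQ1
            · exact Real.one_sub_le_exp_neg _
        _ = Real.exp (-(t / Q)) := by rw [← Real.exp_nat_mul]; congr 1; ring
    have h4 : Real.exp (-(t / Q)) < Real.exp (-L) := by
      rw [Real.exp_lt_exp, neg_lt_neg_iff, lt_div_iff₀ hQ0]; exact htgt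
    have h5 : Real.exp (-L) * R' ^ D = δ ^ D := by
      rw [hL, Real.exp_neg, Real.exp_nat_mul, Real.exp_log (by positivity), div_pow]
      field_simp
    have hR'D : 0 < R' ^ D := by positivity
    nlinarith
  · have he : (1 + δ) ^ D ≤ 3 := by
      calc (1 + δ) ^ D ≤ Real.exp δ ^ D := by
            gcongr; rw [add_comm]; exact Real.add_one_le_exp δ
        _ = Real.exp (D * δ) := by rw [← Real.exp_nat_mul]
        _ ≤ Real.exp 1 := Real.exp_le_exp.2 hdim
        _ ≤ 3 := by linarith [Real.exp_one_lt_d9]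
    have hRD : R' ^ D ≤ 3 * R ^ D := by
      calc R' ^ D ≤ ((1 + δ) * R) ^ D := by gcongr; nlinarith
        _ = (1 + δ) ^ D * R ^ D := mul_pow _ _ _
        _ ≤ 3 * R ^ D := by gcongr
    have hQle : Q ≤ 2 * (2 / δ) * 3 * (3 * R ^ D) := by
      rw [hQ]
      gcongr
      rw [show (2 : ℝ) / δ = 1 / δ + 1 / δ by ring]
      gcongr
      rw [le_div_iff₀ hδ]; linarith
    have hLle : L ≤ 1 / δ * (2 * R / δ) := by
      rw [hL]
      gcongr
      · exact Real.log_nonneg hRδ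
      · rw [le_div_iff₀ hδ]; exact hdim
      · refine (Real.log_le_self (by linarith)).trans ?_
        gcongr; linarith
    have hRD1 : 1 ≤ R ^ D := one_le_pow₀ hR
    have hδ3 : δ ^ 3 ≤ 1 := pow_le_one₀ hδ.le hδ1
    have hone : 1 ≤ R / δ ^ 3 * R ^ D := by
      have : 1 ≤ R / δ ^ 3 := by rw [le_div_iff₀ (by positivity)]; linarith
      nlinarith
    calc (S.card : ℝ) ≤ t := by exact_mod_cast hScard
      _ ≤ L * Q + 1 := by
          rw [ht]; push_cast
          gcongr
          exact Nat.floor_le (by positivity)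
      _ ≤ (1 / δ * (2 * R / δ)) * (2 * (2 / δ) * 3 * (3 * R ^ D)) + R / δ ^ 3 * R ^ D := by
          gcongr
      _ = 73 * R / δ ^ 3 * R ^ D := by field_simp; norm_num

section Ellipsoid

variable {H : Type*} [NormedAddCommGroup H] [InnerProductSpace ℝ H]

theorem HilbertBasis.hasSum_sq_inner (b : HilbertBasis ℕ ℝ H) (x : H) :
    HasSum (fun n => (inner ℝ (b n) x) ^ 2) (‖x‖ ^ 2) := by
  have := b.hasSum_inner_mul_inner x x
  rw [real_inner_self_eq_norm_sq] at this
  simpa only [real_inner_comm, ← sq] using this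

/-- Volumetric lower bound for the cardinality of a covering of the image of the unit ball under
a diagonal operator. -/
theorem prod_le_card_mul_pow_of_cover {T : H →L[ℝ] H} {ψ : ℕ → H} (hON : Orthonormal ℝ ψ)
    {lam : ℕ → ℝ} (heig : ∀ n, T (ψ n) = lam n • ψ n) (hlam : ∀ n, 0 < lam n) (D : ℕ)
    {ε : ℝ} (hε : 0 < ε) (S : Finset H)
    (hS : ∀ x ∈ T '' Metric.closedBall 0 1, ∃ y ∈ S, dist x y ≤ ε) :
    ∏ i ∈ Finset.range D, lam i ≤ S.card * ε ^ D := by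
  classical
  let P : H → EuclideanSpace ℝ (Fin D) := fun x => WithLp.toLp 2 fun i : Fin D => inner ℝ (ψ i) x
  have hON' : Orthonormal ℝ (fun i : Fin D => ψ i) := hON.comp _ Fin.val_injective
  have hPle : ∀ x y, dist (P x) (P y) ≤ dist x y := by
    intro x y
    rw [dist_eq_norm, dist_eq_norm]
    refine le_of_sq_le_sq ?_ (norm_nonneg _)
    rw [EuclideanSpace.real_norm_sq_eq]
    have := hON'.sum_inner_products_le (x := x - y) (s := Finset.univ)
    simp only [Real.norm_eq_abs, sq_abs] at this
    simpa [P, inner_sub_right] using this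
  let f : EuclideanSpace ℝ (Fin D) →ₗ[ℝ] EuclideanSpace ℝ (Fin D) :=
    Matrix.toEuclideanLin (Matrix.diagonal fun i : Fin D => lam i)
  have hf : ∀ v i, f v i = lam i * v i := by
    intro v i
    simp [f, Matrix.toLpLin_apply, Matrix.mulVec_diagonal]
  have hdet : LinearMap.det f = ∏ i ∈ Finset.range D, lam i := by
    simp only [f]
    rw [Matrix.toEuclideanLin_eq_toLin_orthonormal, LinearMap.det_toLin, Matrix.det_diagonal,
      Finset.prod_range]
  have hsub : f '' Metric.closedBall 0 1 ⊆ ⋃ y ∈ S, Metric.closedBall (P y) ε := by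
    rintro _ ⟨v, hv, rfl⟩
    rw [mem_closedBall_zero_iff] at hv
    set u : H := ∑ i : Fin D, v i • ψ i with hu
    have hunorm : ‖u‖ ≤ 1 := by
      refine le_trans (le_of_sq_le_sq ?_ (norm_nonneg v)) hv
      rw [← real_inner_self_eq_norm_sq, hu, hON'.inner_sum, EuclideanSpace.real_norm_sq_eq]
      simp [sq]
    obtain ⟨y, hy, hdist⟩ := hS (T u) ⟨u, by simpa using hunorm, rfl⟩
    have hPT : P (T u) = f v := by
      ext i
      rw [hf]
      have : T u = ∑ i : Fin D, (lam i * v i) • ψ i := by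
        rw [hu, map_sum]
        refine Finset.sum_congr rfl fun i _ => ?_
        rw [map_smul, heig, smul_smul, mul_comm]
      simp only [P, this]
      exact hON'.inner_right_fintype (fun i : Fin D => lam i * v i) i
    simp only [Set.mem_iUnion]
    exact ⟨y, hy, by rw [← hPT, Metric.mem_closedBall]; exact (hPle _ _).trans hdist⟩
  have hprod : 0 < ∏ i ∈ Finset.range D, lam i := Finset.prod_pos fun i _ => hlam i
  have h1 := measureReal_mono (μ := (volume : Measure (EuclideanSpace ℝ (Fin D)))) hsub
    ((measure_biUnion_lt_top S.finite_toSet fun _ _ => measure_closedBall_lt_top).ne)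
  have h2 : (volume : Measure (EuclideanSpace ℝ (Fin D))).real (f '' Metric.closedBall 0 1) =
      (∏ i ∈ Finset.range D, lam i) * (volume : Measure (EuclideanSpace ℝ (Fin D))).real (Metric.closedBall 0 1) := by
    rw [measureReal_def, Measure.addHaar_image_linearMap, hdet, ENNReal.toReal_mul,
      ENNReal.toReal_ofReal (abs_nonneg _), abs_of_pos hprod, measureReal_def]
  have h3 : (volume : Measure (EuclideanSpace ℝ (Fin D))).real (⋃ y ∈ S, Metric.closedBall (P y) ε) ≤
      S.card * ε ^ D * (volume : Measure (EuclideanSpace ℝ (Fin D))).real (Metric.closedBall 0 1) := by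
    refine (measureReal_biUnion_finset_le _ _).trans ?_
    simp only [Measure.addHaar_real_closedBall' (volume : Measure (EuclideanSpace ℝ (Fin D))) _ hε.le, Finset.sum_const,
      nsmul_eq_mul, finrank_euclideanSpace_fin, mul_assoc]
    exact le_rfl
  have hV : 0 < (volume : Measure (EuclideanSpace ℝ (Fin D))).real (Metric.closedBall (0 : EuclideanSpace ℝ (Fin D)) 1) :=
    ENNReal.toReal_pos (Metric.measure_closedBall_pos _ 0 one_pos).ne' measure_closedBall_lt_top.ne
  exact le_of_mul_le_mul_right (h2 ▸ h1.trans h3) hV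

/-- Covering of the image of the unit ball under a diagonal operator, built from a partition of
the large semi-axes into blocks of comparable length. -/
theorem exists_finset_cover_ellipsoid (B : HilbertBasis ℕ ℝ H) {T : H →L[ℝ] H} {lam : ℕ → ℝ}
    (hT : ∀ n u, inner ℝ (B n) (T u) = lam n * inner ℝ (B n) u) (hlam : ∀ n, 0 < lam n)
    {ε : ℝ} (hε : 0 < ε) {d : ℕ} (hsmall : ∀ n, d ≤ n → lam n ≤ ε) {K M : ℕ} (hM : 0 < M)
    (b : Fin d → Fin K) (R : Fin K → ℝ) (hR : ∀ k, 1 ≤ R k) (hb : ∀ i : Fin d, lam i ≤ ε * R (b i))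
    {δ : ℝ} (hδ : 0 < δ) (hδ1 : δ ≤ 1) (hdδ : d * δ ≤ 1) :
    ∃ S : Finset H, (∀ u, ‖u‖ ≤ 1 → ∃ y ∈ S, ‖T u - y‖ ≤ ε * (1 + δ) * √(1 + K / M)) ∧
      (S.card : ℝ) ≤
        (M + 1) ^ K * ((∏ k, (73 * R k / δ ^ 3)) * ∏ i, R (b i)) := by
  classical
  have hcov : ∀ k, ∃ S : Finset (EuclideanSpace ℝ {i // b i = k}),
      (∀ x, ‖x‖ ≤ R k → ∃ y ∈ S, ‖x - y‖ ≤ 1 + δ) ∧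
      (S.card : ℝ) ≤ 73 * R k / δ ^ 3 * R k ^ Fintype.card {i // b i = k} := by
    intro k
    have hdim : (Module.finrank ℝ (EuclideanSpace ℝ {i // b i = k}) : ℝ) * δ ≤ 1 := by
      refine le_trans ?_ hdδ
      gcongr
      rw [finrank_euclideanSpace]
      simpa using Fintype.card_subtype_le (fun i => b i = k)
    obtain ⟨S, h1, h2⟩ := exists_finset_cover_closedBall
      (EuclideanSpace ℝ {i // b i = k}) (hR k) hδ hδ1 hdim
    exact ⟨S, h1, by rwa [finrank_euclideanSpace] at h2⟩
  choose S hS hScard using hcov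
  let c : (Fin K → Fin (M + 1)) → (∀ k, EuclideanSpace ℝ {i // b i = k}) → Fin d → ℝ :=
    fun j s i => ε * √(((j (b i) : ℕ) : ℝ) / M) * s (b i) ⟨i, rfl⟩
  let y : (Fin K → Fin (M + 1)) × (∀ k, EuclideanSpace ℝ {i // b i = k}) → H :=
    fun z => ∑ i : Fin d, c z.1 z.2 i • B i
  refine ⟨((Finset.univ : Finset (Fin K → Fin (M + 1))) ×ˢ Fintype.piFinset S).image y, ?_, ?_⟩
  · intro u hu
    have hMpos : (0 : ℝ) < M := by exact_mod_cast hM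
    set a : ℕ → ℝ := fun n => inner ℝ (B n) u with ha
    have hasum : HasSum (fun n => a n ^ 2) (‖u‖ ^ 2) := B.hasSum_sq_inner u
    set r : Fin K → ℝ := fun k => ∑ i : {i // b i = k}, a i.1 ^ 2 with hr
    have hr0 : ∀ k, 0 ≤ r k := fun k => Finset.sum_nonneg fun _ _ => sq_nonneg _
    have hrsum : ∑ k, r k = ∑ i : Fin d, a i ^ 2 :=
      Fintype.sum_fiberwise b (fun i : Fin d => a i ^ 2)
    have hale : ∑ i : Fin d, a i ^ 2 ≤ ‖u‖ ^ 2 := by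
      rw [Fin.sum_univ_eq_sum_range (fun i => a i ^ 2)]
      exact sum_le_hasSum _ (fun _ _ => sq_nonneg _) hasum
    have hu1 : ‖u‖ ^ 2 ≤ 1 := pow_le_one₀ (norm_nonneg _) hu
    have hr1 : ∀ k, r k ≤ 1 := fun k =>
      (Finset.single_le_sum (fun k _ => hr0 k) (Finset.mem_univ k)).trans
        (by rw [hrsum]; linarith)
    have hjlt : ∀ k, ⌈M * r k⌉₊ < M + 1 := by
      intro k
      rw [Nat.lt_succ_iff, Nat.ceil_le]
      nlinarith [hr1 k]
    let j : Fin K → Fin (M + 1) := fun k => ⟨⌈M * r k⌉₊, hjlt k⟩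
    set ρ : Fin K → ℝ := fun k => √(((j k : ℕ) : ℝ) / M) with hρ
    have hρ0 : ∀ k, 0 ≤ ρ k := fun k => Real.sqrt_nonneg _
    have hρsq : ∀ k, ρ k ^ 2 = ((j k : ℕ) : ℝ) / M := fun k => Real.sq_sqrt (by positivity)
    have hρlow : ∀ k, r k ≤ ρ k ^ 2 := by
      intro k
      rw [hρsq, le_div_iff₀ hMpos, mul_comm]
      exact Nat.le_ceil _
    have hρup : ∀ k, ρ k ^ 2 ≤ r k + 1 / M := by
      intro k
      rw [hρsq, div_le_iff₀ hMpos, add_mul, one_div, inv_mul_cancel₀ hMpos.ne', mul_comm (r k)]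
      exact (Nat.ceil_lt_add_one (mul_nonneg hMpos.le (hr0 k))).le
    let z : ∀ k, EuclideanSpace ℝ {i // b i = k} :=
      fun k => WithLp.toLp 2 fun i => lam i.1 * a i.1
    have hz : ∀ k, ‖z k‖ ≤ ε * R k * ρ k := by
      intro k
      have hRk := hR k
      refine le_of_sq_le_sq ?_ (mul_nonneg (by positivity) (hρ0 k))
      rw [EuclideanSpace.real_norm_sq_eq]
      calc ∑ i, (z k i) ^ 2 = ∑ i : {i // b i = k}, lam i.1 ^ 2 * a i.1 ^ 2 := by
            simp [z, mul_pow]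
        _ ≤ ∑ i : {i // b i = k}, (ε * R k) ^ 2 * a i.1 ^ 2 := by
            refine Finset.sum_le_sum fun i _ => ?_
            have h1 := hb i.1
            rw [i.2] at h1
            have h2 := (hlam i.1).le
            gcongr
        _ = (ε * R k) ^ 2 * r k := by rw [hr, Finset.mul_sum]
        _ ≤ (ε * R k) ^ 2 * ρ k ^ 2 := by gcongr; exact hρlow k
        _ = (ε * R k * ρ k) ^ 2 := by ring
    have hex : ∀ k, ∃ s ∈ S k, ‖z k - (ε * ρ k) • s‖ ≤ ε * ρ k * (1 + δ) := by
      intro k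
      have hRk : 0 < R k := by linarith [hR k]
      rcases (hρ0 k).eq_or_lt with h0 | hpos
      · obtain ⟨s, hs, -⟩ := hS k 0 (by simpa using hRk.le)
        refine ⟨s, hs, ?_⟩
        have := hz k
        rw [← h0] at this ⊢
        simpa using this
      · have hερ : 0 < ε * ρ k := mul_pos hε hpos
        obtain ⟨s, hs, hs2⟩ := hS k ((ε * ρ k)⁻¹ • z k) (by
          rw [norm_smul, norm_inv, Real.norm_eq_abs, abs_of_pos hερ, inv_mul_le_iff₀ hερ]
          linarith [hz k])
        refine ⟨s, hs, ?_⟩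
        have : z k - (ε * ρ k) • s = (ε * ρ k) • ((ε * ρ k)⁻¹ • z k - s) := by
          rw [smul_sub, smul_smul, mul_inv_cancel₀ hερ.ne', one_smul]
        rw [this, norm_smul, Real.norm_eq_abs, abs_of_pos hερ]
        gcongr
    choose s hs hs2 using hex
    refine ⟨y (j, s), Finset.mem_image_of_mem _ (Finset.mem_product.2
      ⟨Finset.mem_univ _, Fintype.mem_piFinset.2 hs⟩), ?_⟩
    set v := T u - y (j, s) with hv
    have hON' : Orthonormal ℝ (fun i : Fin d => B i) := B.orthonormal.comp _ Fin.val_injective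
    have hvlt : ∀ i : Fin d, inner ℝ (B i) v = lam i * a i - c j s i := by
      intro i
      rw [hv, inner_sub_right, hT]
      congr 1
      exact hON'.inner_right_fintype (c j s) i
    have hvge : ∀ n, inner ℝ (B (n + d)) v = lam (n + d) * a (n + d) := by
      intro n
      rw [hv, inner_sub_right, hT, sub_eq_self]
      simp only [y]
      rw [inner_sum]
      refine Finset.sum_eq_zero fun i _ => ?_
      rw [inner_smul_right, B.orthonormal.inner_eq_zero (by have := i.2; omega), mul_zero]
    have hvsum := (hasSum_nat_add_iff' d).2 (B.hasSum_sq_inner v)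
    have husum := (hasSum_nat_add_iff' d).2 hasum
    have htail := hasSum_le (fun n => by
      show (inner ℝ (B (n + d)) v) ^ 2 ≤ ε ^ 2 * a (n + d) ^ 2
      rw [hvge, mul_pow]
      have h1 := hsmall (n + d) (by omega)
      have h2 := (hlam (n + d)).le
      gcongr) hvsum (husum.mul_left (ε ^ 2))
    rw [← Fin.sum_univ_eq_sum_range (fun i => (inner ℝ (B i) v) ^ 2),
      ← Fin.sum_univ_eq_sum_range (fun i => a i ^ 2)] at htail
    have hhead : ∑ i : Fin d, (inner ℝ (B i) v) ^ 2 ≤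
        (ε * (1 + δ)) ^ 2 * (∑ i : Fin d, a i ^ 2 + K / M) := by
      calc ∑ i : Fin d, (inner ℝ (B i) v) ^ 2
          = ∑ k, ∑ i : {i // b i = k}, (inner ℝ (B i.1) v) ^ 2 :=
            (Fintype.sum_fiberwise b (fun i : Fin d => (inner ℝ (B i) v) ^ 2)).symm
        _ = ∑ k, ‖z k - (ε * ρ k) • s k‖ ^ 2 := by
            refine Finset.sum_congr rfl fun k _ => ?_
            rw [EuclideanSpace.real_norm_sq_eq]
            refine Finset.sum_congr rfl fun i _ => ?_
            rw [hvlt]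
            obtain ⟨i, rfl⟩ := i
            simp [z, c, hρ]
        _ ≤ ∑ k, (ε * (1 + δ)) ^ 2 * (r k + 1 / M) := by
            refine Finset.sum_le_sum fun k _ => ?_
            calc ‖z k - (ε * ρ k) • s k‖ ^ 2 ≤ (ε * ρ k * (1 + δ)) ^ 2 := by
                  gcongr; exact hs2 k
              _ = (ε * (1 + δ)) ^ 2 * ρ k ^ 2 := by ring
              _ ≤ _ := by gcongr; exact hρup k
        _ = _ := by
            rw [← Finset.mul_sum, Finset.sum_add_distrib, hrsum]
            simp [div_eq_mul_inv]
    have hKM : (0 : ℝ) ≤ K / M := by positivity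
    refine le_of_sq_le_sq ?_ (by positivity)
    rw [mul_pow, Real.sq_sqrt (by positivity)]
    have hε2 : ε ^ 2 ≤ (ε * (1 + δ)) ^ 2 := by gcongr; nlinarith
    have h3 : ε ^ 2 * (‖u‖ ^ 2 - ∑ i : Fin d, a i ^ 2) ≤
        (ε * (1 + δ)) ^ 2 * (‖u‖ ^ 2 - ∑ i : Fin d, a i ^ 2) := by
      gcongr
    have h4 : (ε * (1 + δ)) ^ 2 * (‖u‖ ^ 2 + K / M) ≤ (ε * (1 + δ)) ^ 2 * (1 + K / M) := by
      gcongr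
    linarith
  · have h1 : (((Finset.univ : Finset (Fin K → Fin (M + 1))) ×ˢ Fintype.piFinset S).image y).card ≤
        (M + 1) ^ K * ∏ k, (S k).card := by
      refine Finset.card_image_le.trans ?_
      rw [Finset.card_product, Fintype.card_piFinset]
      simp
    have h2 : ∏ i, R (b i) = ∏ k, R k ^ Fintype.card {i // b i = k} := by
      rw [← Fintype.prod_fiberwise b (fun i : Fin d => R (b i))]
      refine Finset.prod_congr rfl fun k _ => ?_
      rw [Finset.prod_congr rfl (fun i _ => by rw [i.2] : ∀ i ∈ (Finset.univ :
        Finset {i // b i = k}), R (b i.1) = R k), Finset.prod_const, Finset.card_univ]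
    calc _ ≤ (((M + 1) ^ K * ∏ k, (S k).card : ℕ) : ℝ) := by exact_mod_cast h1
      _ = (M + 1) ^ K * ∏ k, ((S k).card : ℝ) := by push_cast; rfl
      _ ≤ (M + 1) ^ K * ∏ k, (73 * R k / δ ^ 3 * R k ^ Fintype.card {i // b i = k}) := by
          gcongr with k
          exact hScard k
      _ = _ := by rw [Finset.prod_mul_distrib, h2]

end Ellipsoid

section EntropyBounds

variable {H : Type*} [NormedAddCommGroup H] [InnerProductSpace ℝ H]

/-- Covering of the image of the unit ball under a diagonal operator, with an explicit bound for
the logarithm of its cardinality. -/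
theorem exists_finset_cover_log_card_le (B : HilbertBasis ℕ ℝ H) {T : H →L[ℝ] H} {lam : ℕ → ℝ}
    (hT : ∀ n u, inner ℝ (B n) (T u) = lam n * inner ℝ (B n) u) (hlam : ∀ n, 0 < lam n)
    (hanti : Antitone lam) {ε : ℝ} (hε : 0 < ε) {d K : ℕ} (hd : 0 < d)
    (hlarge : ∀ n, n < d → ε < lam n) (hsmall : ∀ n, d ≤ n → lam n ≤ ε)
    (hK : K = ⌊√d * Real.log (lam 0 / ε)⌋₊ + 1) :
    ∃ S : Finset H, (∀ u, ‖u‖ ≤ 1 → ∃ y ∈ S, ‖T u - y‖ ≤ ε * (1 + 1 / d) ^ 2) ∧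
      Real.log S.card ≤ ∑ i ∈ Finset.range d, Real.log (lam i / ε) + √d +
        K * (Real.log (K * d + 1) + Real.log (219 * (lam 0 / ε) * d ^ 3)) := by
  have hdR : (0 : ℝ) < d := by exact_mod_cast hd
  have hd1 : (1 : ℝ) ≤ d := by exact_mod_cast hd
  have hsq : 0 < √(d : ℝ) := Real.sqrt_pos.2 hdR
  have hsq1 : 1 ≤ √(d : ℝ) := Real.one_le_sqrt.2 hd1
  have hKpos : 0 < K := by omega
  have hlogpos : ∀ n, n < d → 0 ≤ Real.log (lam n / ε) := fun n hn =>
    Real.log_nonneg ((one_le_div hε).2 (hlarge n hn).le)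
  have hbK : ∀ i : Fin d, ⌊√d * Real.log (lam i / ε)⌋₊ < K := by
    intro i
    rw [hK, Nat.lt_succ_iff]
    have := hlam i
    gcongr
    exact hanti (Nat.zero_le _)
  let b : Fin d → Fin K := fun i => ⟨⌊√d * Real.log (lam i / ε)⌋₊, hbK i⟩
  let R : Fin K → ℝ := fun k => Real.exp (((k : ℕ) + 1) / √d)
  have hRle : ∀ k, R k ≤ 3 * (lam 0 / ε) := by
    intro k
    have h1 : ((k : ℕ) : ℝ) + 1 ≤ K := by exact_mod_cast k.2
    have h2 : (K : ℝ) ≤ √d * Real.log (lam 0 / ε) + 1 := by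
      rw [hK]; push_cast
      gcongr
      exact Nat.floor_le (mul_nonneg hsq.le (hlogpos 0 hd))
    calc R k ≤ Real.exp (Real.log (lam 0 / ε) + 1) := by
          refine Real.exp_le_exp.2 ?_
          rw [div_le_iff₀ hsq]
          nlinarith
      _ = lam 0 / ε * Real.exp 1 := by
          rw [Real.exp_add, Real.exp_log (div_pos (hlam 0) hε)]
      _ ≤ lam 0 / ε * 3 := by
          have := (div_pos (hlam 0) hε).le
          gcongr
          linarith [Real.exp_one_lt_d9]
      _ = _ := mul_comm _ _
  have hR : ∀ k, 1 ≤ R k := fun k => Real.one_le_exp (by positivity)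
  have hb : ∀ i : Fin d, lam i ≤ ε * R (b i) := by
    intro i
    have h1 := Nat.lt_floor_add_one (√d * Real.log (lam i / ε))
    rw [← div_le_iff₀' hε, ← Real.log_le_iff_le_exp (div_pos (hlam i) hε), le_div_iff₀ hsq]
    linarith
  obtain ⟨S, hS, hcard⟩ := exists_finset_cover_ellipsoid B hT hlam hε hsmall
    (Nat.mul_pos hKpos hd) b R hR hb (δ := 1 / d) (by positivity)
    (by rw [div_le_one hdR]; exact hd1) (by rw [mul_one_div_cancel hdR.ne'])
  refine ⟨S, fun u hu => ?_, ?_⟩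
  · obtain ⟨y, hy, hle⟩ := hS u hu
    refine ⟨y, hy, hle.trans ?_⟩
    have hKR : (0 : ℝ) < K := by exact_mod_cast hKpos
    have : (K : ℝ) / ((K * d : ℕ) : ℝ) = 1 / d := by push_cast; field_simp
    rw [this, pow_two, ← mul_assoc]
    gcongr
    rw [Real.sqrt_le_left (by positivity)]
    have : (0 : ℝ) < 1 / d := by positivity
    nlinarith
  · have hSpos : (0 : ℝ) < S.card := by
      obtain ⟨y, hy, -⟩ := hS 0 (by simp)
      exact_mod_cast Finset.card_pos.2 ⟨y, hy⟩
    have hRpos : ∀ k, 0 < R k := fun k => Real.exp_pos _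
    refine (Real.log_le_log hSpos hcard).trans ?_
    have hp1 : ∀ k ∈ (Finset.univ : Finset (Fin K)), 73 * R k / (1 / (d : ℝ)) ^ 3 ≠ 0 :=
      fun k _ => by have := hRpos k; positivity
    have hp2 : ∀ i ∈ (Finset.univ : Finset (Fin d)), R (b i) ≠ 0 := fun i _ => (hRpos _).ne'
    rw [Real.log_mul (by positivity)
      (mul_ne_zero (Finset.prod_ne_zero_iff.2 hp1) (Finset.prod_ne_zero_iff.2 hp2)),
      Real.log_mul (Finset.prod_ne_zero_iff.2 hp1) (Finset.prod_ne_zero_iff.2 hp2),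
      Real.log_prod hp1, Real.log_prod hp2, Real.log_pow]
    have h1 : ∑ k, Real.log (73 * R k / (1 / (d : ℝ)) ^ 3) ≤
        K * Real.log (219 * (lam 0 / ε) * d ^ 3) := by
      calc _ ≤ ∑ _k : Fin K, Real.log (219 * (lam 0 / ε) * d ^ 3) := by
            refine Finset.sum_le_sum fun k _ => Real.log_le_log ?_ ?_
            · have := hRpos k; positivity
            · rw [one_div, inv_pow, div_inv_eq_mul]
              refine mul_le_mul_of_nonneg_right ?_ (by positivity)
              linarith [hRle k]
        _ = _ := by simp
    have h2 : ∑ i, Real.log (R (b i)) ≤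
        ∑ i ∈ Finset.range d, Real.log (lam i / ε) + √d := by
      calc ∑ i, Real.log (R (b i))
          ≤ ∑ i : Fin d, (Real.log (lam i / ε) + 1 / √d) := by
            refine Finset.sum_le_sum fun i _ => ?_
            simp only [R, b, Real.log_exp]
            rw [add_div]
            gcongr
            rw [div_le_iff₀ hsq, mul_comm _ √(d : ℝ)]
            refine le_trans (Nat.floor_le (mul_nonneg hsq.le (hlogpos i i.2))) le_rfl
        _ = _ := by
            rw [Finset.sum_add_distrib, Fin.sum_univ_eq_sum_range (fun i => Real.log (lam i / ε))]
            simp only [Finset.sum_const, Finset.card_univ, Fintype.card_fin, nsmul_eq_mul]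
            rw [mul_one_div, Real.div_sqrt]
    push_cast
    nlinarith

theorem opEntropy_le_of_cover {T : H →L[ℝ] H} {ε : ℝ} {S : Finset H} {m : ℝ} (hm : 0 ≤ m)
    (hS : ∀ u, ‖u‖ ≤ 1 → ∃ y ∈ S, ‖T u - y‖ ≤ ε)
    (hcard : Real.log S.card ≤ m * Real.log 2) : opEntropy ε T ≤ m := by
  have hlog2 : 0 < Real.log 2 := Real.log_pos one_lt_two
  have hmem : S.card ∈ {n : ℕ | ∃ s : Finset H, s.card = n ∧
      ∀ x ∈ closure (T '' Metric.closedBall 0 1), ∃ y ∈ s, dist x y ≤ ε} := by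
    refine ⟨S, rfl, fun x hx => ?_⟩
    have hcl : IsClosed (⋃ y ∈ S, Metric.closedBall y ε) :=
      S.finite_toSet.isClosed_biUnion fun _ _ => Metric.isClosed_closedBall
    have hsub : T '' Metric.closedBall 0 1 ⊆ ⋃ y ∈ S, Metric.closedBall y ε := by
      rintro _ ⟨u, hu, rfl⟩
      obtain ⟨y, hy, hle⟩ := hS u (by simpa using hu)
      simp only [Set.mem_iUnion]
      exact ⟨y, hy, by rwa [mem_closedBall_iff_norm]⟩
    have := closure_minimal hsub hcl hx
    simp only [Set.mem_iUnion] at this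
    obtain ⟨y, hy, h⟩ := this
    exact ⟨y, hy, h⟩
  have hle : coveringNumber ε (closure (T '' Metric.closedBall 0 1)) ≤ S.card := Nat.sInf_le hmem
  rw [opEntropy, metricEntropy]
  rcases Nat.eq_zero_or_pos (coveringNumber ε (closure (T '' Metric.closedBall 0 1))) with h0 | h0
  · simpa [h0] using hm
  · rw [Real.logb, div_le_iff₀ hlog2]
    exact (Real.log_le_log (by exact_mod_cast h0) (by exact_mod_cast hle)).trans hcard

theorem opEntropyNumber_le_of_cover {T : H →L[ℝ] H} {ε : ℝ} (hε : 0 < ε) {S : Finset H} {m : ℕ}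
    (hS : ∀ u, ‖u‖ ≤ 1 → ∃ y ∈ S, ‖T u - y‖ ≤ ε)
    (hcard : Real.log S.card ≤ m * Real.log 2) : opEntropyNumber m T ≤ ε :=
  csInf_le ⟨0, fun _ h => h.1.le⟩ ⟨hε, opEntropy_le_of_cover (Nat.cast_nonneg m) hS hcard⟩

theorem le_opEntropyNumber {T : H →L[ℝ] H} (hcomp : IsCompactOperator T) {ψ : ℕ → H}
    (hON : Orthonormal ℝ ψ) {lam : ℕ → ℝ} (heig : ∀ n, T (ψ n) = lam n • ψ n)
    (hlam : ∀ n, 0 < lam n) {ε : ℝ} {m D : ℕ}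
    (h : m * Real.log 2 < ∑ i ∈ Finset.range D, Real.log (lam i / ε)) :
    ε ≤ opEntropyNumber m T := by
  have hlog2 : 0 < Real.log 2 := Real.log_pos one_lt_two
  refine le_csInf ⟨‖T‖ + 1, by positivity, ?_⟩ ?_
  · refine opEntropy_le_of_cover (S := {0}) (Nat.cast_nonneg m) (fun u hu => ⟨0, by simp, ?_⟩)
      (by simpa using by positivity)
    rw [sub_zero]
    have := T.le_opNorm u
    have : ‖T‖ * ‖u‖ ≤ ‖T‖ * 1 := by gcongr
    linarith
  · rintro ε' ⟨hε', hent⟩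
    by_contra! hlt
    have hne : {n : ℕ | ∃ s : Finset H, s.card = n ∧
        ∀ x ∈ closure (T '' Metric.closedBall 0 1), ∃ y ∈ s, dist x y ≤ ε'}.Nonempty := by
      have hc : IsCompact (closure (T '' Metric.closedBall 0 1)) :=
        hcomp.isCompact_closure_image_closedBall 1
      obtain ⟨t, -, htfin, ht⟩ := hc.finite_cover_balls hε'
      refine ⟨_, htfin.toFinset, rfl, fun x hx => ?_⟩
      have := ht hx
      simp only [Set.mem_iUnion, Metric.mem_ball] at this
      obtain ⟨y, hy, hd⟩ := this
      exact ⟨y, by simpa using hy, hd.le⟩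
    obtain ⟨S, hScard, hS⟩ := Nat.sInf_mem hne
    have hvol := prod_le_card_mul_pow_of_cover hON heig hlam D hε' S
      fun x hx => hS x (subset_closure hx)
    rw [opEntropy, metricEntropy, coveringNumber, ← hScard, Real.logb, div_le_iff₀ hlog2] at hent
    have hprod : ∏ i ∈ Finset.range D, (lam i / ε') ≤ S.card := by
      rw [Finset.prod_div_distrib, Finset.prod_const, Finset.card_range,
        div_le_iff₀ (by positivity)]
      exact hvol
    have hpos : 0 < ∏ i ∈ Finset.range D, (lam i / ε') :=
      Finset.prod_pos fun i _ => div_pos (hlam i) hε'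
    have h1 := Real.log_le_log hpos hprod
    rw [Real.log_prod fun i _ => (div_pos (hlam i) hε').ne'] at h1
    have h2 : ∑ i ∈ Finset.range D, Real.log (lam i / ε) ≤
        ∑ i ∈ Finset.range D, Real.log (lam i / ε') := by
      refine Finset.sum_le_sum fun i _ => Real.log_le_log (div_pos (hlam i) (hε'.trans hlt)) ?_
      have := hlam i
      gcongr
    linarith

end EntropyBounds

section PowerAsymptotics

theorem tendsto_natCast_add_one_atTop : Tendsto (fun n : ℕ => (n : ℝ) + 1) atTop atTop :=
  tendsto_atTop_add_const_right _ _ tendsto_natCast_atTop_atTop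

theorem isLittleO_log_one_add_sub : (fun x : ℝ => Real.log (1 + x) - x) =o[𝓝 0] fun x => x := by
  have h := (Real.hasDerivAt_log one_ne_zero).isLittleO
  have h2 : Tendsto (fun x : ℝ => 1 + x) (𝓝 0) (𝓝 1) := by
    have : Continuous fun x : ℝ => 1 + x := by fun_prop
    simpa using this.tendsto 0
  simpa [Function.comp_def] using h.comp_tendsto h2

/-- Logarithm of a sequence with a two term power asymptotics. -/
theorem isLittleO_log_of_two_term {lam : ℕ → ℝ} (hlam : ∀ n, 0 < lam n) {c₁ c₂ α₁ α₂ : ℝ}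
    (hc₁ : 0 < c₁) (hcase : α₁ < α₂ ∨ (α₁ = α₂ ∧ c₂ = 0))
    (hasymp : (fun n : ℕ => lam n - c₁ * ((n : ℝ) + 1) ^ (-α₁) - c₂ * ((n : ℝ) + 1) ^ (-α₂))
      =o[atTop] fun n : ℕ => ((n : ℝ) + 1) ^ (-α₂)) :
    (fun n : ℕ => Real.log (lam n) - (Real.log c₁ - α₁ * Real.log ((n : ℝ) + 1)
        + c₂ / c₁ * ((n : ℝ) + 1) ^ (α₁ - α₂)))
      =o[atTop] fun n : ℕ => ((n : ℝ) + 1) ^ (α₁ - α₂) := by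
  set y : ℕ → ℝ := fun n => ((n : ℝ) + 1) ^ (α₁ - α₂) with hy
  set x : ℕ → ℝ := fun n => lam n * ((n : ℝ) + 1) ^ α₁ / c₁ - 1 with hx
  have hpos : ∀ n : ℕ, (0 : ℝ) < n + 1 := fun n => by positivity
  have h1 : (fun n => x n - c₂ / c₁ * y n) =o[atTop] y := by
    have h := (hasymp.mul_isBigO
      (isBigO_refl (fun n : ℕ => ((n : ℝ) + 1) ^ α₁) atTop)).const_mul_left c₁⁻¹
    refine h.congr (fun n => ?_) (fun n => ?_)
    · have e1 : ((n : ℝ) + 1) ^ (-α₁) * ((n : ℝ) + 1) ^ α₁ = 1 := by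
        rw [← Real.rpow_add (hpos n)]; simp
      have e2 : y n = ((n : ℝ) + 1) ^ (-α₂) * ((n : ℝ) + 1) ^ α₁ := by
        rw [← Real.rpow_add (hpos n), neg_add_eq_sub]
      rw [e2, hx]
      field_simp
      linear_combination (-c₁) * e1
    · rw [hy, ← Real.rpow_add (hpos n), neg_add_eq_sub]
  have hxy : x =O[atTop] y := by
    have := h1.isBigO.add ((isBigO_refl y atTop).const_mul_left (c₂ / c₁))
    simpa using this
  have hx0 : Tendsto x atTop (𝓝 0) := by
    rcases hcase with h | ⟨rfl, rfl⟩
    · refine hxy.trans_tendsto ?_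
      have := (tendsto_rpow_neg_atTop (sub_pos.2 h)).comp tendsto_natCast_add_one_atTop
      simpa [Function.comp_def, hy] using this
    · simpa [hy, isLittleO_one_iff] using h1
  have h2 : (fun n => Real.log (1 + x n) - x n) =o[atTop] y :=
    (isLittleO_log_one_add_sub.comp_tendsto hx0).trans_isBigO hxy
  refine (h2.add h1).congr_left fun n => ?_
  have : Real.log (1 + x n) = Real.log (lam n) + α₁ * Real.log ((n : ℝ) + 1) - Real.log c₁ := by
    rw [hx]
    simp only [add_sub_cancel]
    rw [Real.log_div (mul_pos (hlam n) (by positivity)).ne' hc₁.ne',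
      Real.log_mul (hlam n).ne' (by positivity), Real.log_rpow (hpos n)]
  rw [this]
  ring

/-- Consecutive differences of powers. -/
theorem isEquivalent_rpow_succ_sub {s : ℝ} (hs : 0 < s) :
    (fun n : ℕ => ((n : ℝ) + 1) ^ s - (n : ℝ) ^ s) ~[atTop]
      fun n : ℕ => s * ((n : ℝ) + 1) ^ (s - 1) := by
  have hd : HasDerivAt (fun x : ℝ => x ^ s) s 1 := by
    simpa using Real.hasDerivAt_rpow_const (x := 1) (p := s) (Or.inl one_ne_zero)
  have hinv : Tendsto (fun n : ℕ => 1 - ((n : ℝ) + 1)⁻¹) atTop (𝓝 1) := by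
    simpa using (tendsto_inv_atTop_zero.comp tendsto_natCast_add_one_atTop).const_sub 1
  have h := hd.isLittleO.comp_tendsto hinv
  have hmul := (isBigO_refl (fun n : ℕ => ((n : ℝ) + 1) ^ s) atTop).mul_isLittleO h
  refine IsLittleO.trans_isBigO (g := fun n : ℕ => ((n : ℝ) + 1) ^ (s - 1)) ?_ ?_
  · refine hmul.neg_left.neg_right.congr (fun n => ?_) (fun n => ?_)
    · have hpos : (0 : ℝ) < n + 1 := by positivity
      have e : (n : ℝ) ^ s = (n + 1) ^ s * (1 - ((n : ℝ) + 1)⁻¹) ^ s := by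
        rw [← Real.mul_rpow hpos.le]
        · congr 1
          field_simp
          ring
        · rw [sub_nonneg]
          exact inv_le_one_of_one_le₀ (by linarith [n.cast_nonneg (α := ℝ)])
      simp only [Function.comp_apply, Pi.sub_apply, smul_eq_mul, Real.one_rpow]
      rw [e, Real.rpow_sub_one hpos.ne']
      field_simp
      ring
    · have hpos : (0 : ℝ) < n + 1 := by positivity
      simp only [Function.comp_apply]
      rw [Real.rpow_sub_one hpos.ne']
      field_simp
      ring
  · exact (isBigO_refl _ _).const_mul_right hs.ne'

theorem isLittleO_rpow_rpow_atTop {p q : ℝ} (h : p < q) :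
    (fun x : ℝ => x ^ p) =o[atTop] fun x => x ^ q := by
  refine (isLittleO_iff_tendsto' ?_).2 ?_
  · filter_upwards [eventually_gt_atTop 0] with x hx h0
    exact absurd h0 (Real.rpow_pos_of_pos hx q).ne'
  · refine (tendsto_rpow_neg_atTop (sub_pos.2 h)).congr' ?_
    filter_upwards [eventually_gt_atTop 0] with x hx
    rw [← Real.rpow_sub hx, neg_sub]

theorem natCast_mul_log_succ_sub_bounds (n : ℕ) :
    |n * (Real.log (n + 1) - Real.log n) - 1| ≤ ((n : ℝ) + 1)⁻¹ := by
  rcases Nat.eq_zero_or_pos n with rfl | hn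
  · simp
  have hn' : (0 : ℝ) < n := by exact_mod_cast hn
  have h1 : Real.log ((n + 1) / n) ≤ (n + 1) / n - 1 := Real.log_le_sub_one_of_pos (by positivity)
  have h2 : 1 - (((n : ℝ) + 1) / n)⁻¹ ≤ Real.log ((n + 1) / n) :=
    Real.one_sub_inv_le_log_of_pos (by positivity)
  rw [← Real.log_div (by positivity) (by positivity)]
  have e1 : (n : ℝ) * ((n + 1) / n - 1) = 1 := by field_simp; ring
  have e2 : (n : ℝ) * (1 - (((n : ℝ) + 1) / n)⁻¹) - 1 = -((n : ℝ) + 1)⁻¹ := by field_simp; ring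
  have h1' := mul_le_mul_of_nonneg_left h1 hn'.le
  have h2' := mul_le_mul_of_nonneg_left h2 hn'.le
  have : 0 < ((n : ℝ) + 1)⁻¹ := by positivity
  rw [abs_le]
  constructor <;> linarith

/-- Partial sums of logarithms of a sequence with a two term power asymptotics. -/
theorem isLittleO_sum_log {lam : ℕ → ℝ} {ℓ b α₁ s : ℝ} (hs : 0 < s)
    (h : (fun n : ℕ => Real.log (lam n) - (ℓ - α₁ * Real.log ((n : ℝ) + 1)
        + b * ((n : ℝ) + 1) ^ (s - 1)))
      =o[atTop] fun n : ℕ => ((n : ℝ) + 1) ^ (s - 1)) :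
    (fun D : ℕ => ∑ n ∈ Finset.range D, Real.log (lam n)
        - (D * ℓ - α₁ * (D * Real.log D - D) + b / s * (D : ℝ) ^ s))
      =o[atTop] fun D : ℕ => (D : ℝ) ^ s := by
  set g : ℕ → ℝ := fun n => ((n : ℝ) + 1) ^ s - (n : ℝ) ^ s with hg
  have hge := isEquivalent_rpow_succ_sub hs
  have hyg : (fun n : ℕ => ((n : ℝ) + 1) ^ (s - 1)) =O[atTop] g := by
    refine IsBigO.trans ?_ hge.isBigO_symm
    exact (isBigO_refl _ _).const_mul_right hs.ne'
  set F : ℕ → ℝ := fun D => D * ℓ - α₁ * (D * Real.log D - D) + b / s * (D : ℝ) ^ s with hF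
  have hsumg : ∀ D : ℕ, ∑ n ∈ Finset.range D, g n = (D : ℝ) ^ s := fun D => by
    have := Finset.sum_range_sub (fun n : ℕ => (n : ℝ) ^ s) D
    simpa [hg, Real.zero_rpow hs.ne'] using this
  have hinv : (fun n : ℕ => (n : ℝ) * (Real.log (n + 1) - Real.log n) - 1) =o[atTop]
      fun n : ℕ => ((n : ℝ) + 1) ^ (s - 1) := by
    refine IsBigO.trans_isLittleO (g := fun n : ℕ => ((n : ℝ) + 1) ^ (-1 : ℝ)) ?_ ?_
    · refine IsBigO.of_bound 1 (Eventually.of_forall fun n => ?_)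
      rw [one_mul, Real.rpow_neg_one, Real.norm_eq_abs, Real.norm_eq_abs,
        abs_of_pos (a := ((n : ℝ) + 1)⁻¹) (by positivity)]
      exact natCast_mul_log_succ_sub_bounds n
    · exact (isLittleO_rpow_rpow_atTop (by linarith : -1 < s - 1)).comp_tendsto
        tendsto_natCast_add_one_atTop
  have hf : (fun n => Real.log (lam n) - (F (n + 1) - F n)) =o[atTop] g := by
    have h3 := (hge.isLittleO.const_mul_left (b / s)).trans_isBigO
      ((isBigO_refl (fun n : ℕ => ((n : ℝ) + 1) ^ (s - 1)) atTop).const_mul_left s)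
    refine IsLittleO.trans_isBigO ?_ hyg
    refine ((h.add (hinv.const_mul_left α₁)).sub h3).congr_left fun n => ?_
    simp only [hF, Pi.sub_apply]
    push_cast
    field_simp
    ring
  have := hf.sum_range (fun n => ?_) ?_
  · refine (this.congr (fun D => ?_) hsumg)
    rw [Finset.sum_sub_distrib, Finset.sum_range_sub]
    simp [hF, Real.zero_rpow hs.ne']
  · simp only [hg, Pi.zero_apply, sub_nonneg]
    gcongr
    linarith
  · simp_rw [hsumg]
    exact (tendsto_rpow_atTop hs).comp tendsto_natCast_atTop_atTop

/-- The logarithmic volume functional along integers proportional to a large parameter. -/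
theorem isLittleO_sum_log_sub {S : ℕ → ℝ} {ℓ k α₁ s q r : ℝ} (hr : 0 < r)
    (hS : (fun D : ℕ => S D - (D * ℓ - α₁ * (D * Real.log D - D) + k * (D : ℝ) ^ s))
      =o[atTop] fun D : ℕ => (D : ℝ) ^ s)
    {ι : Type*} {l : Filter ι} {Δ : ι → ℝ} (hΔ : Tendsto Δ l atTop) {D : ι → ℕ}
    (hD : Tendsto (fun i => D i / Δ i) l (𝓝 r)) :
    (fun i => S (D i) - D i * (ℓ - α₁ * Real.log (Δ i) + q * Δ i ^ (s - 1))
        - α₁ * (D i * (1 + Real.log (Δ i) - Real.log (D i))) - (k * r ^ s - q * r) * Δ i ^ s)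
      =o[l] fun i => Δ i ^ s := by
  have hΔpos : ∀ᶠ i in l, 0 < Δ i := hΔ.eventually_gt_atTop 0
  have hDtop : Tendsto D l atTop := by
    rw [← tendsto_natCast_atTop_iff (R := ℝ)]
    refine (hD.pos_mul_atTop hr hΔ).congr' ?_
    filter_upwards [hΔpos] with i hi
    field_simp
  have hDs : Tendsto (fun i => (D i : ℝ) ^ s / Δ i ^ s) l (𝓝 (r ^ s)) := by
    refine (hD.rpow_const (Or.inl hr.ne')).congr' ?_
    filter_upwards [hΔpos] with i hi
    rw [Real.div_rpow (Nat.cast_nonneg _) hi.le]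
  have h1 : (fun i => (D i : ℝ) ^ s - r ^ s * Δ i ^ s) =o[l] fun i => Δ i ^ s := by
    refine (isLittleO_iff_tendsto' ?_).2 ?_
    · filter_upwards [hΔpos] with i hi h0
      exact absurd h0 (Real.rpow_pos_of_pos hi s).ne'
    · have := hDs.sub_const (r ^ s)
      rw [sub_self] at this
      refine this.congr' ?_
      filter_upwards [hΔpos] with i hi
      have := Real.rpow_pos_of_pos hi s
      field_simp
  have h2 : (fun i => D i * Δ i ^ (s - 1) - r * Δ i ^ s) =o[l] fun i => Δ i ^ s := by
    refine (isLittleO_iff_tendsto' ?_).2 ?_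
    · filter_upwards [hΔpos] with i hi h0
      exact absurd h0 (Real.rpow_pos_of_pos hi s).ne'
    · have := hD.sub_const r
      rw [sub_self] at this
      refine this.congr' ?_
      filter_upwards [hΔpos] with i hi
      have := Real.rpow_pos_of_pos hi s
      rw [Real.rpow_sub_one hi.ne']
      field_simp
  have h3 : (fun i => (D i : ℝ) ^ s) =O[l] fun i => Δ i ^ s := by
    simpa using h1.isBigO.add ((isBigO_refl (fun i => Δ i ^ s) l).const_mul_left (r ^ s))
  have h4 := (hS.comp_tendsto hDtop).trans_isBigO h3
  refine ((h4.add (h1.const_mul_left k)).sub (h2.const_mul_left q)).congr_left fun i => ?_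
  simp only [Function.comp_apply]
  ring

theorem eventually_lt_sum_log {S : ℕ → ℝ} {ℓ k α₁ s τ : ℝ} (hα₁ : 0 < α₁) (hs : 0 < s)
    (hτ : 0 < τ)
    (hS : (fun D : ℕ => S D - (D * ℓ - α₁ * (D * Real.log D - D) + k * (D : ℝ) ^ s))
      =o[atTop] fun D : ℕ => (D : ℝ) ^ s)
    {ι : Type*} {l : Filter ι} {Δ : ι → ℝ} (hΔ : Tendsto Δ l atTop) :
    ∀ᶠ i in l, α₁ * Δ i <
      S ⌊Δ i⌋₊ - ⌊Δ i⌋₊ * (ℓ - α₁ * Real.log (Δ i) + (k - τ) * Δ i ^ (s - 1)) := by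
  have h := isLittleO_sum_log_sub (q := k - τ) one_pos hS hΔ
    ((tendsto_nat_floor_div_atTop (R := ℝ)).comp hΔ)
  have hlarge := ((tendsto_rpow_atTop hs).comp hΔ).eventually_gt_atTop (α₁ / (τ / 2))
  filter_upwards [isLittleO_iff.1 h (half_pos hτ), hlarge, hΔ.eventually_ge_atTop 1]
    with i hi hi2 hi3
  rw [Real.norm_eq_abs, Real.norm_eq_abs, abs_of_pos (a := Δ i ^ s) (by positivity)] at hi
  rw [Function.comp_apply, div_lt_iff₀ (by positivity)] at hi2
  have hfl : ((⌊Δ i⌋₊ : ℕ) : ℝ) ≤ Δ i := Nat.floor_le (by linarith)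
  have hfl2 : Δ i - 1 < (⌊Δ i⌋₊ : ℕ) := Nat.sub_one_lt_floor _
  have hflpos : (0 : ℝ) < (⌊Δ i⌋₊ : ℕ) := by exact_mod_cast Nat.floor_pos.2 hi3
  have hlog : Real.log (⌊Δ i⌋₊ : ℕ) ≤ Real.log (Δ i) := Real.log_le_log hflpos hfl
  have hmul : Δ i - 1 ≤ ⌊Δ i⌋₊ * (1 + Real.log (Δ i) - Real.log (⌊Δ i⌋₊ : ℕ)) := by
    nlinarith
  have hmul2 := mul_le_mul_of_nonneg_left hmul hα₁.le
  rw [Real.one_rpow] at hi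
  have := (abs_le.1 hi).1
  linarith

theorem eventually_sum_log_le {S : ℕ → ℝ} {ℓ k α₁ s τ r : ℝ} (hα₁ : 0 < α₁)
    (hτ : 0 < τ) (hr : 0 < r) (hk : k * r ^ s = k * r)
    (hS : (fun D : ℕ => S D - (D * ℓ - α₁ * (D * Real.log D - D) + k * (D : ℝ) ^ s))
      =o[atTop] fun D : ℕ => (D : ℝ) ^ s)
    {ι : Type*} {l : Filter ι} {Δ : ι → ℝ} (hΔ : Tendsto Δ l atTop) {D : ι → ℕ}
    (hD : Tendsto (fun i => D i / Δ i) l (𝓝 r)) :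
    ∀ᶠ i in l, S (D i) - D i * (ℓ - α₁ * Real.log (Δ i) + (k + τ) * Δ i ^ (s - 1))
      + τ * r / 2 * Δ i ^ s ≤ α₁ * Δ i := by
  have h := isLittleO_sum_log_sub (q := k + τ) hr hS hΔ hD
  filter_upwards [isLittleO_iff.1 h (half_pos (mul_pos hτ hr)), hΔ.eventually_gt_atTop 0,
    hD.eventually (lt_mem_nhds hr)] with i hi hi2 hi3
  rw [Real.norm_eq_abs, Real.norm_eq_abs, abs_of_pos (a := Δ i ^ s) (by positivity)] at hi
  have hDpos : (0 : ℝ) < D i := by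
    by_contra hcon
    exact absurd hi3 (not_lt.2 (div_nonpos_of_nonpos_of_nonneg (not_lt.1 hcon) hi2.le))
  have hlog := Real.log_le_sub_one_of_pos (div_pos hi2 hDpos)
  rw [Real.log_div hi2.ne' hDpos.ne'] at hlog
  have hmul := mul_le_mul_of_nonneg_left hlog hDpos.le
  have e : (D i : ℝ) * (Δ i / D i - 1) = Δ i - D i := by field_simp
  have hmul2 := mul_le_mul_of_nonneg_left
    (by linarith : (D i : ℝ) * (1 + Real.log (Δ i) - Real.log (D i)) ≤ Δ i) hα₁.le
  have := (abs_le.1 hi).2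
  rw [hk] at this
  linarith

/-- The error term in the covering bound is of lower order. -/
theorem eventually_cover_error_le {A s η : ℝ} (hA : 0 < A) (hs : 1 / 2 < s) (hη : 0 < η) :
    ∀ᶠ d : ℕ in atTop, ∀ x : ℝ, 1 ≤ x → x ≤ (d : ℝ) ^ A → ∀ K : ℕ,
      K = ⌊√d * Real.log x⌋₊ + 1 →
      √d + K * (Real.log (K * d + 1) + Real.log (219 * x * d ^ 3)) ≤ η * (d : ℝ) ^ s := by
  set C : ℝ := 1 + (A + 1) * (A + 8) with hC
  have hCpos : 0 < C := by positivity
  have hlogs := (isLittleO_log_rpow_rpow_atTop (2 : ℝ) (sub_pos.2 hs)).comp_tendsto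
    (tendsto_natCast_atTop_atTop (R := ℝ))
  have hb := isLittleO_iff.1 hlogs (div_pos hη hCpos)
  filter_upwards [hb, tendsto_natCast_atTop_atTop.eventually_ge_atTop (A + 2),
    tendsto_natCast_atTop_atTop.eventually_ge_atTop (219 : ℝ)] with d hb hdA hd x hx1 hxA K hK
  have hdpos : (0 : ℝ) < d := by linarith
  have hx0 : 0 < x := by linarith
  set L := Real.log (d : ℝ) with hL
  have hL1 : 1 ≤ L := by
    rw [hL, Real.le_log_iff_exp_le hdpos]
    linarith [Real.exp_one_lt_d9]
  have hsqrt1 : 1 ≤ √(d : ℝ) := Real.one_le_sqrt.2 (by linarith)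
  have hsqrtd : √(d : ℝ) ≤ d := by
    rw [Real.sqrt_le_left hdpos.le]; nlinarith
  have hlogx0 : 0 ≤ Real.log x := Real.log_nonneg hx1
  have hlogx : Real.log x ≤ A * L := by
    rw [hL, ← Real.log_rpow hdpos]
    exact Real.log_le_log hx0 hxA
  have hLd : L ≤ d := (Real.log_le_sub_one_of_pos hdpos).trans (by linarith)
  have hKle : (K : ℝ) ≤ (A + 1) * (√d * L) := by
    have h1 : ((⌊√d * Real.log x⌋₊ : ℕ) : ℝ) ≤ √d * Real.log x := Nat.floor_le (by positivity)
    have h2 : √d * Real.log x ≤ √d * (A * L) := by gcongr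
    have h3 : 1 ≤ √d * L := by nlinarith
    rw [hK]
    push_cast
    nlinarith
  have hKd : (K : ℝ) ≤ (A + 1) * (d * d) := hKle.trans (by gcongr)
  have hlog1 : Real.log (K * d + 1) ≤ 4 * L := by
    have : (K * d + 1 : ℝ) ≤ (d : ℝ) ^ 4 := by
      have h1 : (K : ℝ) * d ≤ (A + 1) * (d * d) * d := by gcongr
      have h2 : (1 : ℝ) ≤ d * d * d := by
        have : (1 : ℝ) ≤ d := by linarith
        nlinarith [mul_self_nonneg (d : ℝ)]
      have h3 : (A + 2) * (d * d * d) ≤ d * (d * d * d : ℝ) := by gcongr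
      nlinarith
    calc _ ≤ Real.log ((d : ℝ) ^ 4) := Real.log_le_log (by positivity) this
      _ = _ := by rw [Real.log_pow]; norm_num [hL]
  have hlog2 : Real.log (219 * x * d ^ 3) ≤ (A + 4) * L := by
    rw [Real.log_mul (by positivity) (by positivity), Real.log_mul (by positivity) hx0.ne',
      Real.log_pow]
    have : Real.log 219 ≤ L := Real.log_le_log (by norm_num) hd
    push_cast
    linarith
  have hKpos : (0 : ℝ) ≤ K := Nat.cast_nonneg K
  have hmain : √(d : ℝ) + K * (Real.log (K * d + 1) + Real.log (219 * x * d ^ 3))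
      ≤ C * (√d * L ^ 2) := by
    calc √(d : ℝ) + K * (Real.log (K * d + 1) + Real.log (219 * x * d ^ 3))
        ≤ √d * L ^ 2 + (A + 1) * (√d * L) * (4 * L + (A + 4) * L) := by
          gcongr
          · exact le_mul_of_one_le_right (by positivity) (one_le_pow₀ hL1)
          · refine add_nonneg (Real.log_nonneg ?_) (Real.log_nonneg ?_)
            · linarith [mul_nonneg hKpos hdpos.le]
            · have : (1 : ℝ) ≤ d ^ 3 := one_le_pow₀ (by linarith)
              nlinarith
      _ = C * (√d * L ^ 2) := by rw [hC]; ring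
  refine hmain.trans ?_
  simp only [Function.comp_apply, Real.norm_eq_abs, Real.rpow_two] at hb
  rw [abs_of_nonneg (by positivity), abs_of_nonneg (by positivity)] at hb
  have hds : (d : ℝ) ^ s = √d * (d : ℝ) ^ (s - 1 / 2) := by
    rw [Real.sqrt_eq_rpow, ← Real.rpow_add hdpos]; congr 1; ring
  calc C * (√d * L ^ 2) ≤ C * (√d * (η / C * (d : ℝ) ^ (s - 1 / 2))) := by gcongr
    _ = η * (d : ℝ) ^ s := by rw [hds]; field_simp

theorem exists_count_gt {lam : ℕ → ℝ} (hanti : Antitone lam) (h0 : Tendsto lam atTop (𝓝 0))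
    {ε : ℝ} (hε : 0 < ε) :
    ∃ d : ℕ, (∀ n, n < d → ε < lam n) ∧ ∀ n, d ≤ n → lam n ≤ ε := by
  classical
  have hex : ∃ n, lam n ≤ ε := ((h0.eventually (gt_mem_nhds hε)).exists).imp fun _ h => h.le
  exact ⟨Nat.find hex, fun n hn => not_le.1 (Nat.find_min hex hn),
    fun n hn => (hanti hn).trans (Nat.find_spec hex)⟩

/-- The leading order of a sequence with a two term power asymptotics. -/
theorem tendsto_mul_rpow_of_two_term {lam : ℕ → ℝ} {c₁ c₂ α₁ α₂ : ℝ}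
    (hcase : α₁ < α₂ ∨ (α₁ = α₂ ∧ c₂ = 0))
    (hasymp : (fun n : ℕ => lam n - c₁ * ((n : ℝ) + 1) ^ (-α₁) - c₂ * ((n : ℝ) + 1) ^ (-α₂))
      =o[atTop] fun n : ℕ => ((n : ℝ) + 1) ^ (-α₂)) :
    Tendsto (fun n : ℕ => lam n * ((n : ℝ) + 1) ^ α₁) atTop (𝓝 c₁) := by
  have hpos : ∀ n : ℕ, (0 : ℝ) < n + 1 := fun n => by positivity
  have hle : α₁ ≤ α₂ := hcase.elim le_of_lt fun h => h.1.le
  have h2 : (fun n : ℕ => c₂ * ((n : ℝ) + 1) ^ (-α₂)) =o[atTop]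
      fun n : ℕ => ((n : ℝ) + 1) ^ (-α₁) := by
    rcases hcase with h | ⟨-, rfl⟩
    · exact ((isLittleO_rpow_rpow_atTop (neg_lt_neg h)).comp_tendsto
        tendsto_natCast_add_one_atTop).const_mul_left c₂
    · simp
  have h1 : (fun n : ℕ => ((n : ℝ) + 1) ^ (-α₂)) =O[atTop]
      fun n : ℕ => ((n : ℝ) + 1) ^ (-α₁) := by
    refine IsBigO.of_bound 1 (Eventually.of_forall fun n => ?_)
    rw [one_mul, Real.norm_of_nonneg (by positivity), Real.norm_of_nonneg (by positivity)]
    exact Real.rpow_le_rpow_of_exponent_le (by linarith [n.cast_nonneg (α := ℝ)]) (by linarith)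
  have h3 := ((hasymp.trans_isBigO h1).add h2).mul_isBigO
    (isBigO_refl (fun n : ℕ => ((n : ℝ) + 1) ^ α₁) atTop)
  have e : ∀ n : ℕ, ((n : ℝ) + 1) ^ (-α₁) * ((n : ℝ) + 1) ^ α₁ = 1 := fun n => by
    rw [← Real.rpow_add (hpos n)]; simp
  simp only [e] at h3
  have h4 := ((isLittleO_one_iff ℝ).1 h3).add_const c₁
  rw [zero_add] at h4
  refine h4.congr fun n => ?_
  linear_combination (-c₁) * e n

/-- Asymptotics of the counting function of a regularly decaying sequence. -/
theorem tendsto_count_atTop_and_mul_rpow {lam : ℕ → ℝ} (hlam : ∀ n, 0 < lam n) {c α : ℝ}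
    (h : Tendsto (fun n : ℕ => lam n * ((n : ℝ) + 1) ^ α) atTop (𝓝 c))
    {ε : ℕ → ℝ} {d : ℕ → ℕ} (hε : Tendsto ε atTop (𝓝 0))
    (hlarge : ∀ᶠ m in atTop, ∀ n, n < d m → ε m < lam n)
    (hsmall : ∀ᶠ m in atTop, ∀ n, d m ≤ n → lam n ≤ ε m) :
    Tendsto d atTop atTop ∧ Tendsto (fun m => ε m * (d m : ℝ) ^ α) atTop (𝓝 c) := by
  have hd : Tendsto d atTop atTop := by
    refine tendsto_atTop.2 fun N => ?_
    filter_upwards [hε.eventually (gt_mem_nhds (hlam N)), hsmall] with m hm hsmall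
    by_contra! hlt
    exact absurd (hsmall N hlt.le) (not_le.2 hm)
  refine ⟨hd, ?_⟩
  have hlow : Tendsto (fun n : ℕ => lam n * (n : ℝ) ^ α) atTop (𝓝 c) := by
    have hq : Tendsto (fun n : ℕ => ((n : ℝ) / (n + 1)) ^ α) atTop (𝓝 1) := by
      simpa using (tendsto_natCast_div_add_atTop (𝕜 := ℝ) 1).rpow_const (p := α)
        (Or.inl one_ne_zero)
    have := h.mul hq
    rw [mul_one] at this
    refine this.congr fun n => ?_
    rw [Real.div_rpow (by positivity) (by positivity)]
    have : (0 : ℝ) < ((n : ℝ) + 1) ^ α := by positivity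
    field_simp
  have hup : Tendsto (fun m => lam (d m - 1) * (d m : ℝ) ^ α) atTop (𝓝 c) := by
    have hd1 : Tendsto (fun m => d m - 1) atTop atTop := (tendsto_sub_atTop_nat 1).comp hd
    refine (h.comp hd1).congr' ?_
    filter_upwards [hd.eventually_ge_atTop 1] with m hm
    simp [Nat.cast_sub hm]
  refine tendsto_of_tendsto_of_tendsto_of_le_of_le' (hlow.comp hd) hup ?_ ?_
  · filter_upwards [hsmall] with m hsmall
    exact mul_le_mul_of_nonneg_right (hsmall _ le_rfl) (by positivity)
  · filter_upwards [hd.eventually_ge_atTop 1, hlarge] with m hm hlarge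
    exact mul_le_mul_of_nonneg_right (hlarge _ (by omega)).le (by positivity)

/-- Perturbation constants for the upper bound: the relative perturbation `1 + (k + τ) Δ ^ (s - 1)`
converges, and its logarithm exceeds `k Δ ^ (s - 1)` by a definite margin. -/
theorem exists_log_perturbation {k s τ : ℝ} (hτ : 0 < τ) (hcase : s < 1 ∨ (s = 1 ∧ k = 0)) :
    ∃ L τ' : ℝ, 0 < L ∧ 0 < τ' ∧ (L = 1 ∨ (s = 1 ∧ k = 0)) ∧
      Tendsto (fun x : ℝ => 1 + (k + τ) * x ^ (s - 1)) atTop (𝓝 L) ∧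
      ∀ᶠ x : ℝ in atTop, (k + τ') * x ^ (s - 1) ≤ Real.log (1 + (k + τ) * x ^ (s - 1)) := by
  rcases hcase with hs | ⟨rfl, rfl⟩
  · have hy : Tendsto (fun x : ℝ => (k + τ) * x ^ (s - 1)) atTop (𝓝 0) := by
      simpa using (tendsto_rpow_neg_atTop (sub_pos.2 hs)).const_mul (k + τ)
    refine ⟨1, τ / 2, one_pos, half_pos hτ, Or.inl rfl, by simpa using hy.const_add 1, ?_⟩
    have h := (isLittleO_log_one_add_sub.comp_tendsto hy).trans_isBigO
      ((isBigO_refl (fun x : ℝ => x ^ (s - 1)) atTop).const_mul_left (k + τ))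
    filter_upwards [isLittleO_iff.1 h (half_pos hτ), eventually_gt_atTop 0] with x hx hx0
    rw [Real.norm_eq_abs, Real.norm_of_nonneg (by positivity)] at hx
    have := (abs_le.1 hx).1
    simp only [Function.comp_apply] at this
    linarith
  · refine ⟨1 + τ, Real.log (1 + τ), by linarith, Real.log_pos (by linarith), Or.inr ⟨rfl, rfl⟩,
      by simp, Eventually.of_forall fun x => by simp⟩

end PowerAsymptotics

section SecondOrder

variable {H : Type*} [NormedAddCommGroup H] [InnerProductSpace ℝ H]

theorem sum_log_div {lam : ℕ → ℝ} (hlam : ∀ n, 0 < lam n) {ε : ℝ} (hε : 0 < ε) (D : ℕ) :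
    ∑ i ∈ Finset.range D, Real.log (lam i / ε) =
      ∑ i ∈ Finset.range D, Real.log (lam i) - D * Real.log ε := by
  simp_rw [Real.log_div (hlam _).ne' hε.ne']
  simp

theorem log_mul_rpow_mul {c x α y : ℝ} (hc : 0 < c) (hx : 0 < x) (hy : 0 < y) :
    Real.log (c * x ^ (-α) * y) = Real.log c - α * Real.log x + Real.log y := by
  rw [Real.log_mul (by positivity) hy.ne', Real.log_mul hc.ne' (by positivity),
    Real.log_rpow hx]
  ring

theorem eventually_le_opEntropyNumber {T : H →L[ℝ] H} (hcomp : IsCompactOperator T) {ψ : ℕ → H}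
    (hON : Orthonormal ℝ ψ) {lam : ℕ → ℝ} (heig : ∀ n, T (ψ n) = lam n • ψ n)
    (hlam : ∀ n, 0 < lam n) {c₁ k α₁ s τ : ℝ} (hc₁ : 0 < c₁) (hα₁ : 0 < α₁) (hs : 0 < s)
    (hτ : 0 < τ)
    (hS : (fun D : ℕ => ∑ n ∈ Finset.range D, Real.log (lam n)
        - (D * Real.log c₁ - α₁ * (D * Real.log D - D) + k * (D : ℝ) ^ s))
      =o[atTop] fun D : ℕ => (D : ℝ) ^ s)
    {Δ : ℕ → ℝ} (hΔ : Tendsto Δ atTop atTop) (hΔm : ∀ m : ℕ, α₁ * Δ m = m * Real.log 2) :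
    ∀ᶠ m : ℕ in atTop,
      c₁ * Δ m ^ (-α₁) * (1 + (k - τ) * Δ m ^ (s - 1)) ≤ opEntropyNumber m T := by
  filter_upwards [eventually_lt_sum_log hα₁ hs hτ hS hΔ, hΔ.eventually_gt_atTop 0] with m hm hpos
  rcases le_or_gt (1 + (k - τ) * Δ m ^ (s - 1)) 0 with hneg | hy
  · refine (mul_nonpos_of_nonneg_of_nonpos (by positivity) hneg).trans ?_
    exact Real.sInf_nonneg fun _ h => h.1.le
  refine le_opEntropyNumber hcomp hON heig hlam (D := ⌊Δ m⌋₊) ?_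
  rw [sum_log_div hlam (by positivity), log_mul_rpow_mul hc₁ hpos hy, ← hΔm]
  refine hm.trans_le ?_
  have := Real.log_le_sub_one_of_pos hy
  gcongr
  linarith

theorem eventually_opEntropyNumber_le (B : HilbertBasis ℕ ℝ H) {T : H →L[ℝ] H} {lam : ℕ → ℝ}
    (hT : ∀ n u, inner ℝ (B n) (T u) = lam n * inner ℝ (B n) u) (hlam : ∀ n, 0 < lam n)
    (hanti : Antitone lam) {c₁ k α₁ s τ : ℝ} (hc₁ : 0 < c₁) (hα₁ : 0 < α₁) (hs : 1 / 2 < s)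
    (hcase : s < 1 ∨ (s = 1 ∧ k = 0)) (hτ : 0 < τ)
    (hlead : Tendsto (fun n : ℕ => lam n * ((n : ℝ) + 1) ^ α₁) atTop (𝓝 c₁))
    (hS : (fun D : ℕ => ∑ n ∈ Finset.range D, Real.log (lam n)
        - (D * Real.log c₁ - α₁ * (D * Real.log D - D) + k * (D : ℝ) ^ s))
      =o[atTop] fun D : ℕ => (D : ℝ) ^ s)
    {Δ : ℕ → ℝ} (hΔ : Tendsto Δ atTop atTop) (hΔm : ∀ m : ℕ, α₁ * Δ m = m * Real.log 2) :
    ∀ᶠ m : ℕ in atTop,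
      opEntropyNumber m T ≤ c₁ * Δ m ^ (-α₁) * (1 + (k + τ) * Δ m ^ (s - 1)) := by
  obtain ⟨L, τ', hL, hτ', hLcase, hLlim, hLlog⟩ := exists_log_perturbation (half_pos hτ) hcase
  set r : ℝ := (1 / L) ^ α₁⁻¹ with hr_def
  have hr : 0 < r := by positivity
  have hk : k * r ^ s = k * r := by
    rcases hLcase with rfl | ⟨-, rfl⟩
    · simp [hr_def]
    · simp
  set ε : ℕ → ℝ := fun m => c₁ * Δ m ^ (-α₁) * (1 + (k + τ / 2) * Δ m ^ (s - 1)) with hε_def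
  have hΔpos : ∀ᶠ m in atTop, 0 < Δ m := hΔ.eventually_gt_atTop 0
  have hLm : Tendsto (fun m => 1 + (k + τ / 2) * Δ m ^ (s - 1)) atTop (𝓝 L) := hLlim.comp hΔ
  have hpert : ∀ᶠ m in atTop, 0 < 1 + (k + τ / 2) * Δ m ^ (s - 1) :=
    hLm.eventually (lt_mem_nhds hL)
  have hεpos : ∀ᶠ m in atTop, 0 < ε m := by
    filter_upwards [hΔpos, hpert] with m h1 h2
    positivity
  have hε0 : Tendsto ε atTop (𝓝 0) := by
    simpa using (((tendsto_rpow_neg_atTop hα₁).comp hΔ).const_mul c₁).mul hLm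
  have hlam0 : Tendsto lam atTop (𝓝 0) := by
    have := hlead.mul ((tendsto_rpow_neg_atTop hα₁).comp tendsto_natCast_add_one_atTop)
    rw [mul_zero] at this
    refine this.congr fun n => ?_
    have hn : (0 : ℝ) < n + 1 := by positivity
    rw [Function.comp_apply, mul_assoc, ← Real.rpow_add hn, add_neg_cancel, Real.rpow_zero,
      mul_one]
  have hex : ∀ m, ∃ d : ℕ, 0 < ε m →
      (∀ n, n < d → ε m < lam n) ∧ ∀ n, d ≤ n → lam n ≤ ε m := fun m => by
    by_cases h : 0 < ε m
    · exact (exists_count_gt hanti hlam0 h).imp fun _ h _ => h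
    · exact ⟨0, fun h' => absurd h' h⟩
  choose d hd using hex
  obtain ⟨hdtop, hdε⟩ := tendsto_count_atTop_and_mul_rpow hlam hlead hε0
    (hεpos.mono fun m h => (hd m h).1) (hεpos.mono fun m h => (hd m h).2)
  have hdr : Tendsto (fun m => d m / Δ m) atTop (𝓝 r) := by
    have h1 := (hdε.div (hLm.const_mul c₁) (by positivity)).rpow_const (p := α₁⁻¹)
      (Or.inl (by positivity))
    have e : (c₁ / (c₁ * L)) ^ α₁⁻¹ = r := by rw [hr_def]; congr 1; field_simp
    rw [e] at h1
    refine h1.congr' ?_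
    filter_upwards [hΔpos, hpert] with m h1 h2
    have hx : (0 : ℝ) ≤ d m / Δ m := by positivity
    have : ε m * (d m : ℝ) ^ α₁ / (c₁ * (1 + (k + τ / 2) * Δ m ^ (s - 1))) =
        (d m / Δ m) ^ α₁ := by
      simp only [hε_def]
      rw [Real.div_rpow (by positivity) h1.le, Real.rpow_neg h1.le]
      have := Real.rpow_pos_of_pos h1 α₁
      generalize 1 + (k + τ / 2) * Δ m ^ (s - 1) = z at h2 ⊢
      field_simp
    rw [Pi.div_apply, this, Real.rpow_rpow_inv hx hα₁.ne']
  have hdcast : Tendsto (fun m => (d m : ℝ)) atTop atTop := tendsto_natCast_atTop_atTop.comp hdtop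
  have hbig : ∀ᶠ m in atTop, lam 0 < ε m * (d m : ℝ) ^ α₁ * d m :=
    (hdε.pos_mul_atTop hc₁ hdcast).eventually_gt_atTop _
  have hds : ∀ᶠ m in atTop, (d m / Δ m : ℝ) ^ s < r ^ s + 1 :=
    (hdr.rpow_const (p := s) (Or.inl hr.ne')).eventually (gt_mem_nhds (by linarith))
  have hrad : ∀ᶠ m in atTop,
      3 * (c₁ * (1 + (k + τ / 2) * Δ m ^ (s - 1))) * (d m / Δ m : ℝ)⁻¹ * Δ m ^ (-s)
        < c₁ * (τ / 2) := by
    have h := (((hLm.const_mul c₁).const_mul 3).mul (hdr.inv₀ hr.ne')).mul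
      ((tendsto_rpow_neg_atTop (by linarith : 0 < s)).comp hΔ)
    rw [mul_zero] at h
    exact h.eventually (gt_mem_nhds (by positivity))
  have herr := hdtop.eventually (eventually_cover_error_le (A := α₁ + 1)
    (η := τ' * r / 2 / (r ^ s + 1)) (by positivity) hs (by positivity))
  filter_upwards [hΔpos, hpert, hεpos, hdtop.eventually_ge_atTop 1, hbig, hds, hrad, herr,
    hΔ.eventually hLlog, eventually_sum_log_le hα₁ hτ' hr hk hS hΔ hdr]
    with m hΔpos hpert hεpos hd1 hbig hds hrad herr hLlog hsum
  obtain ⟨hlarge, hsmall⟩ := hd m hεpos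
  have hdpos : (0 : ℝ) < d m := by exact_mod_cast hd1
  obtain ⟨S, hScov, hScard⟩ :=
    exists_finset_cover_log_card_le B hT hlam hanti hεpos hd1 hlarge hsmall rfl
  have herr' := herr (lam 0 / ε m) ((one_le_div hεpos).2 (hlarge 0 hd1).le) (by
    rw [div_le_iff₀ hεpos, Real.rpow_add_one hdpos.ne']
    linarith) _ rfl
  have hds' : τ' * r / 2 / (r ^ s + 1) * (d m : ℝ) ^ s ≤ τ' * r / 2 * Δ m ^ s := by
    have hΔs : 0 < Δ m ^ s := by positivity
    rw [Real.div_rpow hdpos.le hΔpos.le, div_lt_iff₀ hΔs] at hds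
    rw [div_mul_eq_mul_div, div_le_iff₀ (by positivity), mul_assoc]
    refine mul_le_mul_of_nonneg_left ?_ (by positivity)
    linarith
  have hcard : Real.log S.card ≤ m * Real.log 2 := by
    rw [sum_log_div hlam hεpos] at hScard
    have hlogε : Real.log c₁ - α₁ * Real.log (Δ m) + (k + τ') * Δ m ^ (s - 1) ≤
        Real.log (ε m) := by
      rw [hε_def, log_mul_rpow_mul hc₁ hΔpos hpert]
      linarith
    have := mul_le_mul_of_nonneg_left hlogε hdpos.le
    rw [← hΔm]
    linarith
  refine (opEntropyNumber_le_of_cover (by positivity) hScov hcard).trans ?_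
  have hinv : 1 / (d m : ℝ) ≤ 1 := by
    rw [div_le_one hdpos]; exact_mod_cast hd1
  have h3 : (1 + 1 / (d m : ℝ)) ^ 2 ≤ 1 + 3 * (1 / (d m : ℝ)) := by
    have : 0 < 1 / (d m : ℝ) := by positivity
    nlinarith
  have hεd : 3 * ε m * (1 / (d m : ℝ)) ≤ c₁ * (τ / 2) * (Δ m ^ (-α₁) * Δ m ^ (s - 1)) := by
    have e : 3 * ε m * (1 / (d m : ℝ)) =
        3 * (c₁ * (1 + (k + τ / 2) * Δ m ^ (s - 1))) * (d m / Δ m : ℝ)⁻¹ * Δ m ^ (-s) *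
          (Δ m ^ (-α₁) * Δ m ^ (s - 1)) := by
      have e2 : Δ m ^ (-s) * Δ m ^ (s - 1) = (Δ m)⁻¹ := by
        rw [← Real.rpow_add hΔpos, ← Real.rpow_neg_one]; congr 1; ring
      have e3 : (d m / Δ m : ℝ)⁻¹ * (Δ m)⁻¹ = 1 / (d m : ℝ) := by field_simp
      rw [hε_def, ← e3, ← e2]
      ring
    rw [e]
    exact mul_le_mul_of_nonneg_right hrad.le (by positivity)
  calc ε m * (1 + 1 / (d m : ℝ)) ^ 2 ≤ ε m * (1 + 3 * (1 / (d m : ℝ))) := by gcongr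
    _ = ε m + 3 * ε m * (1 / (d m : ℝ)) := by ring
    _ ≤ ε m + c₁ * (τ / 2) * (Δ m ^ (-α₁) * Δ m ^ (s - 1)) := by gcongr
    _ = c₁ * Δ m ^ (-α₁) * (1 + (k + τ) * Δ m ^ (s - 1)) := by rw [hε_def]; ring

end SecondOrder

theorem entropyNumbers_of_compact_operator_second_order
    {H : Type*} [NormedAddCommGroup H] [InnerProductSpace ℝ H] [CompleteSpace H]
    [SeparableSpace H]
    (T : H →L[ℝ] H) (hcomp : IsCompactOperator T) (hposop : T.IsPositive)
    -- `ψ` is an orthonormal basis of `H` consisting of eigenvectors of `T`,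
    -- with eigenvalues `lam n` (here `lam n` is the eigenvalue `λ_{n+1}`),
    -- arranged in non-increasing order and counted with multiplicity
    (ψ : ℕ → H) (hON : Orthonormal ℝ ψ)
    (hdense : (Submodule.span ℝ (Set.range ψ)).topologicalClosure = ⊤)
    (lam : ℕ → ℝ) (heig : ∀ n, T (ψ n) = lam n • ψ n)
    (hlampos : ∀ n, 0 < lam n) (hanti : Antitone lam)
    (c₁ c₂ α₁ α₂ : ℝ) (hc₁ : 0 < c₁) (hα₁ : 0 < α₁) (hα₂ : 0 < α₂)
    (hcase : (α₁ < α₂ ∧ α₂ < α₁ + 1 / 2) ∨ (α₁ = α₂ ∧ c₂ = 0))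
    (hasymp : (fun n : ℕ => lam n - c₁ * ((n : ℝ) + 1) ^ (-α₁) - c₂ * ((n : ℝ) + 1) ^ (-α₂))
      =o[atTop] fun n : ℕ => ((n : ℝ) + 1) ^ (-α₂)) :
    (fun m : ℕ => opEntropyNumber m T
        - c₁ * (α₁ / Real.log 2) ^ α₁ * (m : ℝ) ^ (-α₁)
        - c₂ / (α₁ - α₂ + 1) * (α₁ / Real.log 2) ^ α₂ * (m : ℝ) ^ (-α₂))
      =o[atTop] fun m : ℕ => (m : ℝ) ^ (-α₂) := by
  have hlog2 : 0 < Real.log 2 := Real.log_pos one_lt_two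
  have hcase' : α₁ < α₂ ∨ (α₁ = α₂ ∧ c₂ = 0) := hcase.imp_left And.left
  have hs : 1 / 2 < α₁ - α₂ + 1 := by
    rcases hcase with h | h <;> linarith [h.1, h.2]
  set s : ℝ := α₁ - α₂ + 1 with hs_def
  have hs1 : α₁ - α₂ = s - 1 := by rw [hs_def]; ring
  have hlog := isLittleO_log_of_two_term hlampos hc₁ hcase' hasymp
  rw [hs1] at hlog
  have hS := isLittleO_sum_log (by linarith) hlog
  have hlead := tendsto_mul_rpow_of_two_term hcase' hasymp
  set k : ℝ := c₂ / c₁ / s with hk_def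
  have hks : s < 1 ∨ (s = 1 ∧ k = 0) := by
    rcases hcase' with h | ⟨h, rfl⟩
    · exact Or.inl (by linarith)
    · exact Or.inr ⟨by linarith, by simp [hk_def]⟩
  set Δ : ℕ → ℝ := fun m => m * Real.log 2 / α₁ with hΔ_def
  have hΔ : Tendsto Δ atTop atTop :=
    (tendsto_natCast_atTop_atTop.atTop_mul_const hlog2).atTop_div_const hα₁
  have hΔm : ∀ m : ℕ, α₁ * Δ m = m * Real.log 2 := fun m => by
    rw [hΔ_def]; field_simp
  let B : HilbertBasis ℕ ℝ H := HilbertBasis.mk hON hdense.ge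
  have hT : ∀ n u, inner ℝ (B n) (T u) = lam n * inner ℝ (B n) u := fun n u => by
    rw [HilbertBasis.coe_mk, ← hposop.inner_left_eq_inner_right, heig, real_inner_smul_left]
  set C : ℝ := (α₁ / Real.log 2) ^ α₂ with hC_def
  have hC : 0 < C := by positivity
  refine isLittleO_iff.2 fun η hη => ?_
  have hτ : 0 < η / (c₁ * C) := by positivity
  filter_upwards [eventually_le_opEntropyNumber hcomp hON heig hlampos hc₁ hα₁ (by linarith) hτ hS
      hΔ hΔm,
    eventually_opEntropyNumber_le B hT hlampos hanti hc₁ hα₁ hs hks hτ hlead hS hΔ hΔm,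
    eventually_gt_atTop 0] with m hlow hup hm
  have hm' : (0 : ℝ) < m := by exact_mod_cast hm
  have hpow : ∀ α : ℝ, Δ m ^ (-α) = (α₁ / Real.log 2) ^ α * (m : ℝ) ^ (-α) := fun α => by
    have : Δ m = m * (α₁ / Real.log 2)⁻¹ := by rw [hΔ_def]; field_simp
    rw [this, Real.mul_rpow hm'.le (by positivity), Real.inv_rpow (by positivity),
      Real.rpow_neg (by positivity : 0 ≤ α₁ / Real.log 2), inv_inv, mul_comm]
  have hmul : Δ m ^ (-α₁) * Δ m ^ (s - 1) = C * (m : ℝ) ^ (-α₂) := by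
    rw [← Real.rpow_add (by positivity), ← hpow]
    congr 1
    linarith
  have hexp : ∀ q : ℝ, c₁ * Δ m ^ (-α₁) * (1 + q * Δ m ^ (s - 1)) =
      c₁ * (α₁ / Real.log 2) ^ α₁ * (m : ℝ) ^ (-α₁) + c₁ * q * (C * (m : ℝ) ^ (-α₂)) := fun q => by
    rw [← hmul]
    linear_combination c₁ * hpow α₁
  rw [hexp] at hlow hup
  have e : c₂ / s = c₁ * k := by rw [hk_def]; field_simp
  have eη : c₁ * (η / (c₁ * C)) * (C * (m : ℝ) ^ (-α₂)) = η * (m : ℝ) ^ (-α₂) := by field_simp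
  rw [Real.norm_eq_abs, Real.norm_of_nonneg (by positivity), abs_le, e]
  constructor <;> linarith
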